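/- arXiv:1702.04451 — 5 statements merged into one kernel-verified Lean document; each statement's English description precedes it below -/
import Mathlib

section
/- Existence and uniqueness of the fixed point (Lemma 4.1): Let L be a contact Lagrangian, φ ∈ C(ℝⁿ,ℝ) be ℤⁿ-periodic and T' > 0. Then the operator A_φ admits a unique fixed point u ∈ C(ℝⁿ × [0,T'], ℝ) (ℤⁿ-periodic in x), i.e. a unique continuous u with A_φ[u] = u. -/
open Set Filter

noncomputable section

/-- A contact Lagrangian on `ℝⁿ` (playing the role of the flat torus `ℝⁿ/ℤⁿ`),
with Lipschitz constant `lam` in the `u`-variable: continuity, `ℤⁿ`-periodicity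
in `x`, (L1) strict convexity in `v`, (L2) superlinearity in `v`, and
(L3) uniform `lam`-Lipschitz continuity in `u`. -/
def IsContactLagrangian (n : ℕ) (lam : ℝ)
    (L : (Fin n → ℝ) → ℝ → (Fin n → ℝ) → ℝ) : Prop :=
  Continuous (fun q : (Fin n → ℝ) × ℝ × (Fin n → ℝ) => L q.1 q.2.1 q.2.2) ∧
  (∀ (x : Fin n → ℝ) (u : ℝ) (v : Fin n → ℝ) (k : Fin n → ℤ),
    L (fun i => x i + k i) u v = L x u v) ∧
  (∀ x u, StrictConvexOn ℝ Set.univ (fun v => L x u v)) ∧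
  (∀ x u C, ∃ R : ℝ, ∀ v : Fin n → ℝ, R ≤ ‖v‖ → C * ‖v‖ ≤ L x u v) ∧
  0 < lam ∧
  (∀ x v u u', |L x u v - L x u' v| ≤ lam * |u - u'|)

/-- Lipschitz curves `γ : [0,t] → ℝⁿ` with `γ 0 = x₀` and `γ t = x`. -/
def AdmissibleCurve (n : ℕ) (t : ℝ) (x₀ x : Fin n → ℝ)
    (γ : ℝ → Fin n → ℝ) : Prop :=
  (∃ K : NNReal, LipschitzOnWith K γ (Set.Icc 0 t)) ∧ γ 0 = x₀ ∧ γ t = x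

/-- The implicit action `∫₀ᵗ L(γ(τ), w(γ(τ),τ), γ̇(τ)) dτ` of a curve `γ`. -/
def curveCost (n : ℕ) (L : (Fin n → ℝ) → ℝ → (Fin n → ℝ) → ℝ)
    (w : (Fin n → ℝ) → ℝ → ℝ) (t : ℝ) (γ : ℝ → Fin n → ℝ) : ℝ :=
  ∫ τ in (0:ℝ)..t, L (γ τ) (w (γ τ) τ) (deriv γ τ)

/-- `h` is an implicit action function for `L` with data `(x₀, u₀)`:
it is continuous on `ℝⁿ × (0,∞)`, tends to `u₀` as `(y,s) → (x₀,0⁺)`, and for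
every `(x,t)` the value `h x t` equals
`u₀ + inf_γ ∫₀ᵗ L(γ(τ), h(γ(τ),τ), γ̇(τ)) dτ` over admissible Lipschitz curves,
the infimum being attained (`IsLeast`). -/
def ImplicitAction (n : ℕ) (L : (Fin n → ℝ) → ℝ → (Fin n → ℝ) → ℝ)
    (x₀ : Fin n → ℝ) (u₀ : ℝ) (h : (Fin n → ℝ) → ℝ → ℝ) : Prop :=
  ContinuousOn (fun q : (Fin n → ℝ) × ℝ => h q.1 q.2) (Set.univ ×ˢ Set.Ioi 0) ∧
  Filter.Tendsto (fun q : (Fin n → ℝ) × ℝ => h q.1 q.2)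
    ((nhds x₀) ×ˢ (nhdsWithin 0 (Set.Ioi 0))) (nhds u₀) ∧
  (∀ x t, 0 < t →
    IsLeast {A : ℝ | ∃ γ, AdmissibleCurve n t x₀ x γ ∧ A = u₀ + curveCost n L h t γ}
      (h x t))

/-- A minimizer of `h x t`. -/
def IsMinimizer (n : ℕ) (L : (Fin n → ℝ) → ℝ → (Fin n → ℝ) → ℝ)
    (x₀ : Fin n → ℝ) (u₀ : ℝ) (h : (Fin n → ℝ) → ℝ → ℝ)
    (x : Fin n → ℝ) (t : ℝ) (γ : ℝ → Fin n → ℝ) : Prop :=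
  AdmissibleCurve n t x₀ x γ ∧ h x t = u₀ + curveCost n L h t γ

/-- A `ℤⁿ`-periodic continuous function on `ℝⁿ`. -/
def PerCont (n : ℕ) (φ : (Fin n → ℝ) → ℝ) : Prop :=
  Continuous φ ∧ ∀ (x : Fin n → ℝ) (k : Fin n → ℤ), φ (fun i => x i + k i) = φ x

/-- `T` is the backward solution semigroup for the contact Lagrangian `L` with
initial datum `φ`: `(x,t) ↦ T t x` is jointly continuous on `ℝⁿ × [0,∞)`,
each `T t` is `ℤⁿ`-periodic, `T 0 = φ`, and for `t > 0`,
`T t x = inf_γ { φ(γ 0) + ∫₀ᵗ L(γ(τ), T τ (γ τ), γ̇(τ)) dτ }` over Lipschitz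
curves `γ : [0,t] → ℝⁿ` with `γ t = x`, the infimum being attained. -/
def BackwardSemigroup (n : ℕ) (L : (Fin n → ℝ) → ℝ → (Fin n → ℝ) → ℝ)
    (φ : (Fin n → ℝ) → ℝ) (T : ℝ → (Fin n → ℝ) → ℝ) : Prop :=
  ContinuousOn (fun q : (Fin n → ℝ) × ℝ => T q.2 q.1) (Set.univ ×ˢ Set.Ici 0) ∧
  (∀ t, 0 ≤ t → ∀ (x : Fin n → ℝ) (k : Fin n → ℤ),
    T t (fun i => x i + k i) = T t x) ∧
  (∀ x, T 0 x = φ x) ∧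
  (∀ t, 0 < t → ∀ x,
    IsLeast {A : ℝ | ∃ γ : ℝ → Fin n → ℝ,
      (∃ K : NNReal, LipschitzOnWith K γ (Set.Icc 0 t)) ∧ γ t = x ∧
      A = φ (γ 0) + ∫ τ in (0:ℝ)..t, L (γ τ) (T τ (γ τ)) (deriv γ τ)} (T t x))

/-- The operator `A_φ`:
`A_φ[u](x,t) = inf_γ { φ(γ 0) + ∫₀ᵗ L(γ(s), u(γ(s),s), γ̇(s)) ds }`,
the infimum over Lipschitz curves `γ : [0,t] → ℝⁿ` with `γ t = x`. -/
def Aop (n : ℕ) (L : (Fin n → ℝ) → ℝ → (Fin n → ℝ) → ℝ)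
    (φ : (Fin n → ℝ) → ℝ) (u : (Fin n → ℝ) → ℝ → ℝ)
    (x : Fin n → ℝ) (t : ℝ) : ℝ :=
  sInf {A : ℝ | ∃ γ : ℝ → Fin n → ℝ,
    (∃ K : NNReal, LipschitzOnWith K γ (Set.Icc 0 t)) ∧ γ t = x ∧
    A = φ (γ 0) + ∫ τ in (0:ℝ)..t, L (γ τ) (u (γ τ) τ) (deriv γ τ)}

/-- Membership in `C(ℝⁿ × [0,T'], ℝ)` with `ℤⁿ`-periodicity in `x`. -/
def GoodFun (n : ℕ) (T' : ℝ) (u : (Fin n → ℝ) → ℝ → ℝ) : Prop :=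
  ContinuousOn (fun q : (Fin n → ℝ) × ℝ => u q.1 q.2) (Set.univ ×ˢ Set.Icc 0 T') ∧
  ∀ (x : Fin n → ℝ) (t : ℝ) (k : Fin n → ℤ), u (fun i => x i + k i) t = u x t


lemma fp_reduce {n : ℕ} (x : Fin n → ℝ) :
    ∃ k : Fin n → ℤ, (fun i => x i + (k i : ℝ)) ∈ Set.Icc (0 : Fin n → ℝ) 1 := by
  refine ⟨fun i => -⌊x i⌋, ?_, ?_⟩
  · intro i
    have := Int.floor_le (x i)
    simp only [Pi.zero_apply]
    push_cast
    linarith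
  · intro i
    have := Int.lt_floor_add_one (x i)
    simp only [Pi.one_apply]
    push_cast
    linarith

lemma fp_local {n : ℕ} {lam : ℝ} {L : (Fin n → ℝ) → ℝ → (Fin n → ℝ) → ℝ}
    (hL : IsContactLagrangian n lam L) (x₀ : Fin n → ℝ) :
    ∃ U ∈ nhds x₀, ∃ m : ℝ, ∀ x ∈ U, ∀ v, m ≤ L x 0 v := by
  obtain ⟨hc, -, hconv, hsup, -, -⟩ := hL
  obtain ⟨R₀, hR₀⟩ := hsup x₀ 0 1
  set R : ℝ := max R₀ (|L x₀ 0 0| + 2) with hR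
  have hRpos : 0 < R := lt_of_lt_of_le (by positivity) (le_max_right _ _)
  have hg : Continuous (fun q : (Fin n → ℝ) × (Fin n → ℝ) => L q.1 0 q.2) :=
    hc.comp (continuous_fst.prodMk (continuous_const.prodMk continuous_snd))
  have h0 : Continuous (fun q : (Fin n → ℝ) × (Fin n → ℝ) => L q.1 0 0) :=
    hc.comp (continuous_fst.prodMk (continuous_const.prodMk continuous_const))
  have hev : ∀ᶠ x in nhds x₀, ∀ v ∈ Metric.sphere (0 : Fin n → ℝ) R, L x 0 0 < L x 0 v := by
    apply (isCompact_sphere (0 : Fin n → ℝ) R).eventually_forall_of_forall_eventually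
    intro v hv
    have hv' : ‖v‖ = R := by simpa using hv
    have h1 := hR₀ v (by rw [hv']; exact le_max_left _ _)
    have h2 : |L x₀ 0 0| + 2 ≤ R := le_max_right _ _
    have h3 := le_abs_self (L x₀ 0 0)
    have : L x₀ 0 0 < L x₀ 0 v := by rw [hv'] at h1; linarith
    exact (h0.continuousAt (x := (x₀, v))).eventually_lt
      (hg.continuousAt (x := (x₀, v))) this
  obtain ⟨m, hm⟩ := (((isCompact_closedBall x₀ 1).prod
    (isCompact_closedBall (0 : Fin n → ℝ) R)).bddBelow_image hg.continuousOn)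
  have hball : ∀ᶠ x in nhds x₀, x ∈ Metric.closedBall x₀ 1 :=
    Metric.closedBall_mem_nhds _ one_pos
  refine ⟨_, hev.and hball, m, ?_⟩
  rintro x ⟨hx1, hx2⟩ v
  have key : ∀ w, ‖w‖ ≤ R → m ≤ L x 0 w := fun w hw =>
    hm ⟨(x, w), ⟨hx2, by simpa using hw⟩, rfl⟩
  by_cases hv : ‖v‖ ≤ R
  · exact key v hv
  push Not at hv
  have hvp : 0 < ‖v‖ := hRpos.trans hv
  set a : ℝ := R / ‖v‖ with ha
  have ha0 : 0 < a := by positivity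
  have ha1 : a < 1 := by rw [ha, div_lt_one hvp]; exact hv
  have hs := hx1 (a • v) (by
    simp only [mem_sphere_iff_norm, sub_zero, norm_smul, Real.norm_eq_abs, abs_of_pos ha0]
    rw [ha]; field_simp)
  have hcv := (hconv x 0).convexOn.2 (Set.mem_univ 0) (Set.mem_univ v)
    (sub_nonneg.2 ha1.le) ha0.le (by ring)
  simp only [smul_zero, zero_add, smul_eq_mul] at hcv
  have hk := key 0 (by simpa using hRpos.le)
  have : a * L x 0 0 < a * L x 0 v := by nlinarith
  have := lt_of_mul_lt_mul_left this ha0.le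
  linarith

lemma fp_lower {n : ℕ} {lam : ℝ} {L : (Fin n → ℝ) → ℝ → (Fin n → ℝ) → ℝ}
    (hL : IsContactLagrangian n lam L) : ∃ m : ℝ, ∀ x v, m ≤ L x 0 v := by
  have : ∃ m : ℝ, ∀ x ∈ Set.Icc (0 : Fin n → ℝ) 1, ∀ v, m ≤ L x 0 v := by
    apply isCompact_Icc.induction_on (p := fun s => ∃ m : ℝ, ∀ x ∈ s, ∀ v, m ≤ L x 0 v)
    · exact ⟨0, by simp⟩
    · rintro s t hst ⟨m, hm⟩
      exact ⟨m, fun x hx => hm x (hst hx)⟩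
    · rintro s t ⟨m, hm⟩ ⟨m', hm'⟩
      refine ⟨min m m', ?_⟩
      rintro x (hx | hx) v
      · exact (min_le_left _ _).trans (hm x hx v)
      · exact (min_le_right _ _).trans (hm' x hx v)
    · intro x _
      obtain ⟨U, hU, m, hm⟩ := fp_local hL x
      exact ⟨U, mem_nhdsWithin_of_mem_nhds hU, m, hm⟩
  obtain ⟨m, hm⟩ := this
  refine ⟨m, fun x v => ?_⟩
  obtain ⟨k, hk⟩ := fp_reduce x
  rw [← hL.2.1 x 0 v k]
  exact hm _ hk v

lemma fp_bdd {n : ℕ} {T' : ℝ} {u : (Fin n → ℝ) → ℝ → ℝ} (hu : GoodFun n T' u) :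
    ∃ B : ℝ, 0 ≤ B ∧ ∀ x, ∀ t ∈ Set.Icc (0:ℝ) T', |u x t| ≤ B := by
  obtain ⟨B, hB⟩ := ((isCompact_Icc (a := (0 : Fin n → ℝ)) (b := 1)).prod
    (isCompact_Icc (a := (0:ℝ)) (b := T'))).exists_bound_of_continuousOn
    (hu.1.mono (Set.prod_mono (Set.subset_univ _) le_rfl))
  refine ⟨max B 0, le_max_right _ _, fun x t ht => ?_⟩
  obtain ⟨k, hk⟩ := fp_reduce x
  rw [← hu.2 x t k]
  exact (hB (_, t) ⟨hk, ht⟩).trans (le_max_left _ _)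

lemma fp_integrable {n : ℕ} {lam : ℝ} {L : (Fin n → ℝ) → ℝ → (Fin n → ℝ) → ℝ}
    (hL : IsContactLagrangian n lam L) {T' : ℝ} {u : (Fin n → ℝ) → ℝ → ℝ}
    (hu : GoodFun n T' u) {t : ℝ} (ht : t ∈ Set.Icc (0:ℝ) T')
    {γ : ℝ → Fin n → ℝ} {K : NNReal} (hγ : LipschitzOnWith K γ (Set.Icc 0 t)) :
    IntervalIntegrable (fun τ => L (γ τ) (u (γ τ) τ) (deriv γ τ)) MeasureTheory.volume 0 t := by
  have hγc : ContinuousOn γ (Set.Icc 0 t) := hγ.continuousOn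
  have huc : ContinuousOn (fun τ => u (γ τ) τ) (Set.Icc 0 t) :=
    hu.1.comp (f := fun τ => (γ τ, τ)) (hγc.prodMk continuousOn_id)
      (fun τ hτ => ⟨trivial, hτ.1, hτ.2.trans ht.2⟩)
  rw [intervalIntegrable_iff_integrableOn_Ioo_of_le ht.1]
  obtain ⟨C, hC⟩ := ((isCompact_Icc.image_of_continuousOn hγc).prod
    ((isCompact_Icc.image_of_continuousOn huc).prod
      (isCompact_closedBall (0 : Fin n → ℝ) K))).exists_bound_of_continuousOn hL.1.continuousOn
  refine MeasureTheory.IntegrableOn.of_bound (by simp) ?_ C ?_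
  · have hm1 := (hγc.mono Set.Ioo_subset_Icc_self).aestronglyMeasurable
      (μ := MeasureTheory.volume) measurableSet_Ioo
    have hm2 := (huc.mono Set.Ioo_subset_Icc_self).aestronglyMeasurable
      (μ := MeasureTheory.volume) measurableSet_Ioo
    exact hL.1.comp_aestronglyMeasurable
      (hm1.prodMk (hm2.prodMk (aestronglyMeasurable_deriv γ _)))
  · refine MeasureTheory.ae_restrict_of_forall_mem measurableSet_Ioo fun τ hτ => ?_
    have hτ' := Set.Ioo_subset_Icc_self hτ
    refine hC (γ τ, u (γ τ) τ, deriv γ τ) ⟨⟨τ, hτ', rfl⟩, ⟨τ, hτ', rfl⟩, ?_⟩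
    simpa using norm_deriv_le_of_lipschitzOn (Icc_mem_nhds hτ.1 hτ.2) hγ

lemma fp_Aop_le {n : ℕ} {lam : ℝ} {L : (Fin n → ℝ) → ℝ → (Fin n → ℝ) → ℝ}
    (hL : IsContactLagrangian n lam L) {φ : (Fin n → ℝ) → ℝ} (hφ : PerCont n φ)
    {T' : ℝ} {u : (Fin n → ℝ) → ℝ → ℝ}
    (hu : GoodFun n T' u) {t : ℝ} (ht : t ∈ Set.Icc (0:ℝ) T')
    {γ : ℝ → Fin n → ℝ} {K : NNReal} (hγ : LipschitzOnWith K γ (Set.Icc 0 t)) :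
    Aop n L φ u (γ t) t ≤ φ (γ 0) + ∫ τ in (0:ℝ)..t, L (γ τ) (u (γ τ) τ) (deriv γ τ) := by
  refine csInf_le ?_ ⟨γ, ⟨K, hγ⟩, rfl, rfl⟩
  obtain ⟨B, hB0, hB⟩ := fp_bdd hu
  obtain ⟨m, hm⟩ := fp_lower hL
  obtain ⟨D, hD⟩ := (isCompact_Icc (a := (0 : Fin n → ℝ)) (b := 1)).bddBelow_image
    hφ.1.continuousOn
  have hlam := hL.2.2.2.2.1
  refine ⟨D + ∫ _ in (0:ℝ)..t, (m - lam * B), ?_⟩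
  rintro A ⟨η, ⟨K', hη⟩, -, rfl⟩
  apply add_le_add
  · obtain ⟨k, hk⟩ := fp_reduce (η 0)
    rw [← hφ.2 (η 0) k]
    exact hD ⟨_, hk, rfl⟩
  · apply intervalIntegral.integral_mono_on ht.1 (by simp) (fp_integrable hL hu ht hη)
    intro τ hτ
    have h1 := hL.2.2.2.2.2 (η τ) (deriv η τ) (u (η τ) τ) 0
    rw [sub_zero] at h1
    have h2 := hB (η τ) τ ⟨hτ.1, hτ.2.trans ht.2⟩
    have h3 := mul_le_mul_of_nonneg_left h2 hlam.le
    have h4 := hm (η τ) (deriv η τ)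
    have h5 := neg_abs_le (L (η τ) (u (η τ) τ) (deriv η τ) - L (η τ) 0 (deriv η τ))
    linarith

lemma fp_contract {n : ℕ} {lam : ℝ} {L : (Fin n → ℝ) → ℝ → (Fin n → ℝ) → ℝ}
    (hL : IsContactLagrangian n lam L) {φ : (Fin n → ℝ) → ℝ} (hφ : PerCont n φ)
    {T' : ℝ}
    (hatt : ∀ u, GoodFun n T' u → ∀ (x : Fin n → ℝ), ∀ t ∈ Set.Icc (0:ℝ) T',
      Aop n L φ u x t ∈ {A : ℝ | ∃ γ : ℝ → Fin n → ℝ,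
        (∃ K : NNReal, LipschitzOnWith K γ (Set.Icc 0 t)) ∧ γ t = x ∧
        A = φ (γ 0) + ∫ τ in (0:ℝ)..t, L (γ τ) (u (γ τ) τ) (deriv γ τ)})
    {u w : (Fin n → ℝ) → ℝ → ℝ} (hu : GoodFun n T' u) (hw : GoodFun n T' w)
    {M : ℝ} (hM : 0 ≤ M)
    (h : ∀ x, ∀ t ∈ Set.Icc (0:ℝ) T', |u x t - w x t| ≤ M * Real.exp (2 * lam * t)) :
    ∀ x, ∀ t ∈ Set.Icc (0:ℝ) T',
      |Aop n L φ u x t - Aop n L φ w x t| ≤ M / 2 * Real.exp (2 * lam * t) := by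
  have hlam := hL.2.2.2.2.1
  have main : ∀ {u w : (Fin n → ℝ) → ℝ → ℝ}, GoodFun n T' u → GoodFun n T' w →
      (∀ x, ∀ t ∈ Set.Icc (0:ℝ) T', |u x t - w x t| ≤ M * Real.exp (2 * lam * t)) →
      ∀ x, ∀ t ∈ Set.Icc (0:ℝ) T',
      Aop n L φ u x t - Aop n L φ w x t ≤ M / 2 * Real.exp (2 * lam * t) := by
    intro u w hu hw h x t ht
    obtain ⟨γ, ⟨K, hγ⟩, rfl, hA⟩ := hatt w hw x t ht
    have h1 := fp_Aop_le hL hφ hu ht hγ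
    have i1 := fp_integrable hL hu ht hγ
    have i2 := fp_integrable hL hw ht hγ
    have hd : ∀ s : ℝ, HasDerivAt (fun s => M / 2 * Real.exp (2 * lam * s))
        (lam * (M * Real.exp (2 * lam * s))) s := by
      intro s
      have := (((hasDerivAt_id s).const_mul (2 * lam)).exp).const_mul (M / 2)
      exact this.congr_deriv (by simp only [id]; ring)
    have hcont : Continuous (fun s => lam * (M * Real.exp (2 * lam * s))) := by fun_prop
    have i3 := hcont.intervalIntegrable (μ := MeasureTheory.volume) 0 t
    have hI := intervalIntegral.integral_eq_sub_of_hasDerivAt (fun s _ => hd s) i3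
    have h2 : ∫ τ in (0:ℝ)..t, L (γ τ) (u (γ τ) τ) (deriv γ τ) ≤
        ∫ τ in (0:ℝ)..t, (L (γ τ) (w (γ τ) τ) (deriv γ τ)
          + lam * (M * Real.exp (2 * lam * τ))) := by
      apply intervalIntegral.integral_mono_on ht.1 i1 (i2.add i3)
      intro τ hτ
      have h3 := hL.2.2.2.2.2 (γ τ) (deriv γ τ) (u (γ τ) τ) (w (γ τ) τ)
      have h4 := mul_le_mul_of_nonneg_left (h (γ τ) τ ⟨hτ.1, hτ.2.trans ht.2⟩) hlam.le
      have h5 := le_abs_self (L (γ τ) (u (γ τ) τ) (deriv γ τ) - L (γ τ) (w (γ τ) τ) (deriv γ τ))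
      linarith
    rw [intervalIntegral.integral_add i2 i3, hI] at h2
    have : 0 ≤ M / 2 * Real.exp (2 * lam * 0) := by positivity
    linarith
  intro x t ht
  rw [abs_le]
  refine ⟨?_, main hu hw h x t ht⟩
  have := main hw hu (fun x t ht => by rw [abs_sub_comm]; exact h x t ht) x t ht
  linarith

lemma fp_small {a C : ℝ} (h : ∀ k : ℕ, |a| ≤ C / 2 ^ k) : a = 0 := by
  have ht : Tendsto (fun k : ℕ => C / 2 ^ k) atTop (nhds 0) := by
    have := (tendsto_pow_atTop_nhds_zero_of_lt_one (r := (1/2 : ℝ)) (by norm_num)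
      (by norm_num)).const_mul C
    simpa [div_eq_mul_inv] using this
  exact abs_nonpos_iff.1 (ge_of_tendsto' ht h)

/-- **Existence and uniqueness of the fixed point (Lemma 4.1).**
Let `L` be a contact Lagrangian, `φ` a `ℤⁿ`-periodic continuous function and
`T' > 0`.  Assume that `A_φ` maps `C(ℝⁿ × [0,T'], ℝ)` (with periodicity) into
itself and that the defining infimum is always attained.  Then `A_φ` admits a
unique fixed point in this space. -/
theorem fixed_point_existence_uniqueness
    (n : ℕ) (hn : 1 ≤ n) (lam : ℝ)
    (L : (Fin n → ℝ) → ℝ → (Fin n → ℝ) → ℝ)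
    (hL : IsContactLagrangian n lam L)
    (φ : (Fin n → ℝ) → ℝ) (hφ : PerCont n φ)
    (T' : ℝ) (hT' : 0 < T')
    (hmaps : ∀ u, GoodFun n T' u → GoodFun n T' (Aop n L φ u))
    (hatt : ∀ u, GoodFun n T' u → ∀ (x : Fin n → ℝ), ∀ t ∈ Set.Icc (0:ℝ) T',
      Aop n L φ u x t ∈ {A : ℝ | ∃ γ : ℝ → Fin n → ℝ,
        (∃ K : NNReal, LipschitzOnWith K γ (Set.Icc 0 t)) ∧ γ t = x ∧
        A = φ (γ 0) + ∫ τ in (0:ℝ)..t, L (γ τ) (u (γ τ) τ) (deriv γ τ)}) :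
    (∃ u, GoodFun n T' u ∧
      ∀ (x : Fin n → ℝ), ∀ t ∈ Set.Icc (0:ℝ) T', Aop n L φ u x t = u x t) ∧
    (∀ u v, GoodFun n T' u → GoodFun n T' v →
      (∀ (x : Fin n → ℝ), ∀ t ∈ Set.Icc (0:ℝ) T', Aop n L φ u x t = u x t) →
      (∀ (x : Fin n → ℝ), ∀ t ∈ Set.Icc (0:ℝ) T', Aop n L φ v x t = v x t) →
      ∀ (x : Fin n → ℝ), ∀ t ∈ Set.Icc (0:ℝ) T', u x t = v x t) := by
  have hlam := hL.2.2.2.2.1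
  have hdiff : ∀ u v, GoodFun n T' u → GoodFun n T' v → ∃ M : ℝ, 0 ≤ M ∧
      ∀ x, ∀ t ∈ Set.Icc (0:ℝ) T', |u x t - v x t| ≤ M * Real.exp (2 * lam * t) := by
    intro u v hu hv
    obtain ⟨B, hB0, hB⟩ := fp_bdd hu
    obtain ⟨B', hB0', hB'⟩ := fp_bdd hv
    refine ⟨B + B', by positivity, fun x t ht => ?_⟩
    have h1 : (1:ℝ) ≤ Real.exp (2 * lam * t) :=
      Real.one_le_exp (mul_nonneg (by linarith) ht.1)
    have h2 := abs_sub (u x t) (v x t)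
    have h3 := hB x t ht
    have h4 := hB' x t ht
    nlinarith
  constructor
  · set z : ℕ → (Fin n → ℝ) → ℝ → ℝ := fun k => (Aop n L φ)^[k] (fun _ _ => 0) with hz
    have zs : ∀ k, z (k + 1) = Aop n L φ (z k) := fun k =>
      Function.iterate_succ_apply' _ _ _
    have zg : ∀ k, GoodFun n T' (z k) := by
      intro k
      induction k with
      | zero => exact ⟨continuousOn_const, fun _ _ _ => rfl⟩
      | succ k ih => rw [zs]; exact hmaps _ ih
    obtain ⟨M, hM0, hM⟩ := hdiff _ _ (zg 0) (zg 1)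
    have hk : ∀ k : ℕ, ∀ x, ∀ t ∈ Set.Icc (0:ℝ) T',
        |z k x t - z (k + 1) x t| ≤ M / 2 ^ k * Real.exp (2 * lam * t) := by
      intro k
      induction k with
      | zero => simpa using hM
      | succ k ih =>
        have := fp_contract hL hφ hatt (zg k) (zg (k+1)) (by positivity) ih
        rw [← zs, ← zs] at this
        intro x t ht
        convert this x t ht using 2
        rw [pow_succ, div_div]
    set u : (Fin n → ℝ) → ℝ → ℝ := fun x t => limUnder atTop (fun k => z k x t) with hu
    have hgeo : ∀ x, ∀ t ∈ Set.Icc (0:ℝ) T', ∀ k : ℕ,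
        dist (z k x t) (z (k + 1) x t) ≤ (2 * M * Real.exp (2 * lam * t)) / 2 / 2 ^ k := by
      intro x t ht k
      rw [Real.dist_eq]
      refine (hk k x t ht).trans (le_of_eq ?_)
      ring
    have hlim : ∀ x, ∀ t ∈ Set.Icc (0:ℝ) T', Tendsto (fun k => z k x t) atTop (nhds (u x t)) :=
      fun x t ht => (cauchySeq_of_le_geometric_two (hgeo x t ht)).tendsto_limUnder
    have hb : ∀ k : ℕ, ∀ x, ∀ t ∈ Set.Icc (0:ℝ) T',
        |z k x t - u x t| ≤ 2 * M / 2 ^ k * Real.exp (2 * lam * t) := by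
      intro k x t ht
      have := dist_le_of_le_geometric_two_of_tendsto (hgeo x t ht) (hlim x t ht) k
      rw [Real.dist_eq] at this
      refine this.trans (le_of_eq ?_)
      ring
    have ug : GoodFun n T' u := by
      constructor
      · have hunif : TendstoUniformlyOn (fun k (q : (Fin n → ℝ) × ℝ) => z k q.1 q.2)
            (fun q => u q.1 q.2) atTop (Set.univ ×ˢ Set.Icc 0 T') := by
          rw [Metric.tendstoUniformlyOn_iff]
          intro ε hε
          have ht : Tendsto (fun k : ℕ => 2 * M / 2 ^ k * Real.exp (2 * lam * T'))
              atTop (nhds 0) := by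
            have := (tendsto_pow_atTop_nhds_zero_of_lt_one (r := (1/2 : ℝ)) (by norm_num)
              (by norm_num)).const_mul (2 * M * Real.exp (2 * lam * T'))
            rw [mul_zero] at this
            refine this.congr fun k => ?_
            rw [one_div, inv_pow]; ring
          filter_upwards [ht.eventually_lt_const hε] with k hk q hq
          rw [dist_comm, Real.dist_eq]
          refine lt_of_le_of_lt ((hb k q.1 q.2 hq.2).trans ?_) hk
          have := hq.2.2
          gcongr
        exact hunif.continuousOn (Frequently.of_forall fun k => (zg k).1)
      · intro x t k
        simp only [hu]
        congr 1
        funext j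
        exact (zg j).2 x t k
    refine ⟨u, ug, fun x t ht => ?_⟩
    rw [← sub_eq_zero]
    apply fp_small (C := 2 * M * Real.exp (2 * lam * t))
    intro k
    have h1 := fp_contract hL hφ hatt (zg k) ug (by positivity) (hb k) x t ht
    rw [← zs] at h1
    have h2 := hb (k + 1) x t ht
    have h3 := abs_sub_le (Aop n L φ u x t) (z (k+1) x t) (u x t)
    rw [abs_sub_comm (Aop n L φ u x t) (z (k+1) x t)] at h3
    refine (h3.trans (add_le_add h1 h2)).trans (le_of_eq ?_)
    rw [pow_succ]
    field_simp
    ring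
  · intro u v hu hv fu fv x t ht
    obtain ⟨M, hM0, hM⟩ := hdiff u v hu hv
    have hk : ∀ k : ℕ, ∀ x, ∀ t ∈ Set.Icc (0:ℝ) T',
        |u x t - v x t| ≤ M / 2 ^ k * Real.exp (2 * lam * t) := by
      intro k
      induction k with
      | zero => simpa using hM
      | succ k ih =>
        intro x t ht
        have := fp_contract hL hφ hatt hu hv (by positivity) ih x t ht
        rw [fu x t ht, fv x t ht] at this
        rwa [pow_succ, ← div_div]
    rw [← sub_eq_zero]
    apply fp_small (C := M * Real.exp (2 * lam * t))
    intro k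
    refine (hk k x t ht).trans (le_of_eq ?_)
    ring
end
end

section
/- The semigroup gives a variational solution (Lemma 4.2): Let L be a contact Lagrangian and T_t the backward solution semigroup, with minimizers of T_tφ(x) being C¹ curves. Then for every ℤⁿ-periodic φ ∈ C(ℝⁿ,ℝ) and every T > 0, the function u(x,t) := T_tφ(x) is a variational solution of w_t + H(x,w,w_x) = 0 on ℝⁿ × [0,T]: (i) for every continuous piecewise C¹ curve γ : [t₁,t₂] → ℝⁿ with 0 ≤ t₁ < t₂ ≤ T, u(γ(t₂),t₂) − u(γ(t₁),t₁) ≤ ∫_{t₁}^{t₂} L(γ(s), u(γ(s),s), γ'(s)) ds; (ii) for every 0 ≤ t₁ < t₂ ≤ T and every x ∈ ℝⁿ there exists a C¹ curve γ : [t₁,t₂] → ℝⁿ with γ(t₂) = x and u(x,t₂) − u(γ(t₁),t₁) = ∫_{t₁}^{t₂} L(γ(s), u(γ(s),s), γ'(s)) ds. -/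
open Set Filter

noncomputable section

/-- A continuous, piecewise `C¹` curve on `[t₁, t₂]`. -/
def PiecewiseC1On (n : ℕ) (γ : ℝ → Fin n → ℝ) (t₁ t₂ : ℝ) : Prop :=
  ContinuousOn γ (Set.Icc t₁ t₂) ∧
  ∃ (m : ℕ) (s : Fin (m + 1) → ℝ), StrictMono s ∧ s 0 = t₁ ∧ s (Fin.last m) = t₂ ∧
    ∀ j : Fin m, ContDiffOn ℝ 1 γ (Set.Icc (s j.castSucc) (s j.succ))

theorem aux_lip_glue {n : ℕ} {γ : ℝ → Fin n → ℝ} {a b c : ℝ} (hab : a ≤ b) (hbc : b ≤ c)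
    (h1 : ∃ K : NNReal, LipschitzOnWith K γ (Set.Icc a b))
    (h2 : ∃ K : NNReal, LipschitzOnWith K γ (Set.Icc b c)) :
    ∃ K : NNReal, LipschitzOnWith K γ (Set.Icc a c) := by
  obtain ⟨K1, h1⟩ := h1
  obtain ⟨K2, h2⟩ := h2
  have key : ∀ x ∈ Set.Icc a c, ∀ y ∈ Set.Icc a c, x ≤ y →
      dist (γ x) (γ y) ≤ (K1 + K2 : ℝ) * dist x y := by
    intro x hx y hy hxy
    have e : dist x y = y - x := by
      rw [dist_comm, Real.dist_eq, abs_of_nonneg (by linarith)]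
    have p1 : (0:ℝ) ≤ K1 := K1.2
    have p2 : (0:ℝ) ≤ K2 := K2.2
    rcases le_total y b with hyb | hyb
    · have := h1.dist_le_mul x ⟨hx.1, hxy.trans hyb⟩ y ⟨hy.1, hyb⟩
      have h0 : (0:ℝ) ≤ dist x y := dist_nonneg
      nlinarith
    · rcases le_total b x with hxb | hxb
      · have := h2.dist_le_mul x ⟨hxb, hx.2⟩ y ⟨hyb, hy.2⟩
        have h0 : (0:ℝ) ≤ dist x y := dist_nonneg
        nlinarith
      · have i1 := h1.dist_le_mul x ⟨hx.1, hxb⟩ b ⟨hab, le_rfl⟩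
        have i2 := h2.dist_le_mul b ⟨le_rfl, hbc⟩ y ⟨hyb, hy.2⟩
        have i3 := dist_triangle (γ x) (γ b) (γ y)
        have e1 : dist x b = b - x := by
          rw [dist_comm, Real.dist_eq, abs_of_nonneg (by linarith)]
        have e2 : dist b y = y - b := by
          rw [dist_comm, Real.dist_eq, abs_of_nonneg (by linarith)]
        rw [e1] at i1
        rw [e2] at i2
        rw [e]
        nlinarith [mul_nonneg p1 (sub_nonneg.2 hyb), mul_nonneg p2 (sub_nonneg.2 hxb)]
  refine ⟨K1 + K2, LipschitzOnWith.of_dist_le_mul ?_⟩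
  intro x hx y hy
  push_cast
  rcases le_total x y with h | h
  · exact key x hx y hy h
  · rw [dist_comm, dist_comm x y]
    exact key y hy x hx h

theorem aux_lip_C1 {n : ℕ} {γ : ℝ → Fin n → ℝ} {a b : ℝ} (hab : a < b)
    (h : ContDiffOn ℝ 1 γ (Set.Icc a b)) :
    ∃ K : NNReal, LipschitzOnWith K γ (Set.Icc a b) := by
  have hc := h.continuousOn_derivWithin (uniqueDiffOn_Icc hab) le_rfl
  obtain ⟨C, hC⟩ := isCompact_Icc.exists_bound_of_continuousOn hc
  refine ⟨C.toNNReal, ?_⟩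
  refine (convex_Icc a b).lipschitzOnWith_of_nnnorm_derivWithin_le
    (h.differentiableOn one_ne_zero) ?_
  intro x hx
  rw [← NNReal.coe_le_coe]
  exact (hC x hx).trans (Real.le_coe_toNNReal C)

theorem aux_int_C1 {n : ℕ} {L : (Fin n → ℝ) → ℝ → (Fin n → ℝ) → ℝ}
    (hL : Continuous (fun q : (Fin n → ℝ) × ℝ × (Fin n → ℝ) => L q.1 q.2.1 q.2.2))
    {T : ℝ → (Fin n → ℝ) → ℝ}
    (hT : ContinuousOn (fun q : (Fin n → ℝ) × ℝ => T q.2 q.1) (Set.univ ×ˢ Set.Ici 0))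
    {γ : ℝ → Fin n → ℝ} {a b : ℝ} (ha : 0 ≤ a) (hab : a < b)
    (h : ContDiffOn ℝ 1 γ (Set.Icc a b)) :
    IntervalIntegrable (fun s => L (γ s) (T s (γ s)) (deriv γ s)) MeasureTheory.volume a b := by
  have hc := h.continuousOn_derivWithin (uniqueDiffOn_Icc hab) le_rfl
  have hg := h.continuousOn
  have hu : ContinuousOn (fun s => T s (γ s)) (Set.Icc a b) := by
    have := hT.comp (f := fun s => (γ s, s)) (s := Set.Icc a b) (hg.prodMk continuousOn_id)
      (fun s hs => ⟨Set.mem_univ _, ha.trans hs.1⟩)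
    exact this
  have hF : ContinuousOn (fun s => L (γ s) (T s (γ s)) (derivWithin γ (Set.Icc a b) s))
      (Set.Icc a b) :=
    hL.comp_continuousOn (hg.prodMk (hu.prodMk hc))
  have hi : IntervalIntegrable (fun s => L (γ s) (T s (γ s)) (derivWithin γ (Set.Icc a b) s))
      MeasureTheory.volume a b := by
    apply ContinuousOn.intervalIntegrable
    rwa [Set.uIcc_of_le hab.le]
  refine hi.congr_uIoo ?_
  intro s hs
  rw [Set.uIoo_of_le hab.le] at hs
  simp only [derivWithin_of_mem_nhds (Icc_mem_nhds hs.1 hs.2)]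

/-- Lipschitz with integrable action. -/
theorem aux_pw {n : ℕ} {L : (Fin n → ℝ) → ℝ → (Fin n → ℝ) → ℝ}
    (hL : Continuous (fun q : (Fin n → ℝ) × ℝ × (Fin n → ℝ) => L q.1 q.2.1 q.2.2))
    {T : ℝ → (Fin n → ℝ) → ℝ}
    (hT : ContinuousOn (fun q : (Fin n → ℝ) × ℝ => T q.2 q.1) (Set.univ ×ˢ Set.Ici 0))
    {γ : ℝ → Fin n → ℝ} {a b : ℝ} (ha : 0 ≤ a)
    (h : PiecewiseC1On n γ a b) :
    (∃ K : NNReal, LipschitzOnWith K γ (Set.Icc a b)) ∧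
    IntervalIntegrable (fun s => L (γ s) (T s (γ s)) (deriv γ s)) MeasureTheory.volume a b := by
  obtain ⟨-, m, s, hs, rfl, rfl, hj⟩ := h
  have key : ∀ i : Fin (m + 1), (∃ K : NNReal, LipschitzOnWith K γ (Set.Icc (s 0) (s i))) ∧
    IntervalIntegrable (fun s => L (γ s) (T s (γ s)) (deriv γ s)) MeasureTheory.volume
      (s 0) (s i) := by
    intro i
    induction i using Fin.induction with
    | zero =>
      refine ⟨⟨0, ?_⟩, IntervalIntegrable.refl⟩
      rw [Set.Icc_self]
      intro x hx y hy
      rw [Set.mem_singleton_iff] at hx hy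
      simp [hx, hy]
    | succ j ih =>
      have h0 : s 0 ≤ s j.castSucc := hs.monotone (Fin.zero_le _)
      have h1 : s j.castSucc < s j.succ := hs Fin.castSucc_lt_succ
      exact ⟨aux_lip_glue h0 h1.le ih.1 (aux_lip_C1 h1 (hj j)),
        ih.2.trans (aux_int_C1 hL hT (ha.trans h0) h1 (hj j))⟩
  exact key _

/-- **The semigroup gives a variational solution (Lemma 4.2).**
Let `L` be a contact Lagrangian and `T` the backward solution semigroup with
`ℤⁿ`-periodic continuous initial datum `φ`, whose minimizers are `C¹` curves.
Then for every `T' > 0` the function `u(x,t) = T t x` is a variational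
solution of `w_t + H(x,w,w_x) = 0` on `ℝⁿ × [0,T']`: (i) along every
continuous piecewise `C¹` curve the increment of `u` is at most the Lagrangian
action; (ii) for every `0 ≤ t₁ < t₂ ≤ T'` and every `x` there is a calibrated
`C¹` curve ending at `x`. -/
theorem semigroup_is_variational_solution
    (n : ℕ) (hn : 1 ≤ n) (lam : ℝ)
    (L : (Fin n → ℝ) → ℝ → (Fin n → ℝ) → ℝ)
    (hL : IsContactLagrangian n lam L)
    (φ : (Fin n → ℝ) → ℝ) (hφ : PerCont n φ)
    (T : ℝ → (Fin n → ℝ) → ℝ) (hT : BackwardSemigroup n L φ T)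
    (hC1min : ∀ (t : ℝ), 0 < t → ∀ x : Fin n → ℝ, ∃ γ : ℝ → Fin n → ℝ,
      ContDiffOn ℝ 1 γ (Set.Icc 0 t) ∧ γ t = x ∧
      T t x = φ (γ 0) + ∫ τ in (0:ℝ)..t, L (γ τ) (T τ (γ τ)) (deriv γ τ))
    (T' : ℝ) (hT' : 0 < T') :
    (∀ (t₁ t₂ : ℝ) (γ : ℝ → Fin n → ℝ), 0 ≤ t₁ → t₁ < t₂ → t₂ ≤ T' →
      PiecewiseC1On n γ t₁ t₂ →
      T t₂ (γ t₂) - T t₁ (γ t₁) ≤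
        ∫ s in t₁..t₂, L (γ s) (T s (γ s)) (deriv γ s)) ∧
    (∀ (t₁ t₂ : ℝ) (x : Fin n → ℝ), 0 ≤ t₁ → t₁ < t₂ → t₂ ≤ T' →
      ∃ γ : ℝ → Fin n → ℝ, ContDiffOn ℝ 1 γ (Set.Icc t₁ t₂) ∧ γ t₂ = x ∧
        T t₂ x - T t₁ (γ t₁) =
          ∫ s in t₁..t₂, L (γ s) (T s (γ s)) (deriv γ s)) := by
  obtain ⟨hTc, -, hT0, hTm⟩ := hT
  have hLc := hL.1
  have part1 : ∀ (t₁ t₂ : ℝ) (γ : ℝ → Fin n → ℝ), 0 ≤ t₁ → t₁ < t₂ →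
      (∃ K : NNReal, LipschitzOnWith K γ (Set.Icc t₁ t₂)) →
      IntervalIntegrable (fun s => L (γ s) (T s (γ s)) (deriv γ s)) MeasureTheory.volume t₁ t₂ →
      T t₂ (γ t₂) - T t₁ (γ t₁) ≤
        ∫ s in t₁..t₂, L (γ s) (T s (γ s)) (deriv γ s) := by
    intro t₁ t₂ γ h0 h12 hlip hint
    rcases h0.eq_or_lt with rfl | h0
    · have := (hTm t₂ h12 (γ t₂)).2 ⟨γ, hlip, rfl, rfl⟩
      rw [hT0]
      linarith
    · obtain ⟨η, hη, hηt, hηm⟩ := hC1min t₁ h0 (γ t₁)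
      have hηl := aux_lip_C1 h0 hη
      have hηi := aux_int_C1 hLc hTc le_rfl h0 hη
      obtain ⟨ζ, hζ⟩ : ∃ ζ : ℝ → Fin n → ℝ, ζ = fun s => if s ≤ t₁ then η s else γ s := ⟨_, rfl⟩
      have e1 : ∀ s, s ≤ t₁ → ζ s = η s := fun s hs => by simp [hζ, hs]
      have e2 : ∀ s, t₁ ≤ s → ζ s = γ s := by
        intro s hs
        rcases hs.eq_or_lt with rfl | hs
        · rw [e1 _ le_rfl, hηt]
        · simp [hζ, not_le.2 hs]
      have d1 : ∀ s, s < t₁ → deriv ζ s = deriv η s := fun s hs =>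
        Filter.EventuallyEq.deriv_eq (by
          filter_upwards [Iio_mem_nhds hs] with r hr using e1 r hr.le)
      have d2 : ∀ s, t₁ < s → deriv ζ s = deriv γ s := fun s hs =>
        Filter.EventuallyEq.deriv_eq (by
          filter_upwards [Ioi_mem_nhds hs] with r hr using e2 r hr.le)
      have E1 : Set.EqOn (fun s => L (η s) (T s (η s)) (deriv η s))
          (fun s => L (ζ s) (T s (ζ s)) (deriv ζ s)) (Set.uIoo 0 t₁) := by
        intro s hs
        rw [Set.uIoo_of_le h0.le] at hs
        simp only [e1 s hs.2.le, d1 s hs.2]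
      have E2 : Set.EqOn (fun s => L (γ s) (T s (γ s)) (deriv γ s))
          (fun s => L (ζ s) (T s (ζ s)) (deriv ζ s)) (Set.uIoo t₁ t₂) := by
        intro s hs
        rw [Set.uIoo_of_le h12.le] at hs
        simp only [e2 s hs.1.le, d2 s hs.1]
      have hl : ∃ K : NNReal, LipschitzOnWith K ζ (Set.Icc 0 t₂) := by
        refine aux_lip_glue h0.le h12.le ?_ ?_
        · obtain ⟨K, hK⟩ := hηl
          refine ⟨K, fun x hx y hy => ?_⟩
          rw [e1 x hx.2, e1 y hy.2]
          exact hK hx hy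
        · obtain ⟨K, hK⟩ := hlip
          refine ⟨K, fun x hx y hy => ?_⟩
          rw [e2 x hx.1, e2 y hy.1]
          exact hK hx hy
      have := (hTm t₂ (h0.trans h12) (γ t₂)).2 ⟨ζ, hl, e2 _ h12.le, rfl⟩
      rw [← intervalIntegral.integral_add_adjacent_intervals (hηi.congr_uIoo E1)
        (hint.congr_uIoo E2), e1 0 h0.le, ← intervalIntegral.integral_congr_uIoo E1,
        ← intervalIntegral.integral_congr_uIoo E2] at this
      linarith
  refine ⟨?_, ?_⟩
  · intro t₁ t₂ γ h0 h12 _ hγ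
    obtain ⟨h1, h2⟩ := aux_pw hLc hTc h0 hγ
    exact part1 t₁ t₂ γ h0 h12 h1 h2
  · intro t₁ t₂ x h0 h12 _
    obtain ⟨γ, hγ, hx, hm⟩ := hC1min t₂ (h0.trans_lt h12) x
    have hγ2 : ContDiffOn ℝ 1 γ (Set.Icc t₁ t₂) := hγ.mono (Set.Icc_subset_Icc_left h0)
    refine ⟨γ, hγ2, hx, ?_⟩
    have hi2 := aux_int_C1 hLc hTc h0 h12 hγ2
    have h1 := part1 t₁ t₂ γ h0 h12 (aux_lip_C1 h12 hγ2) hi2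
    rw [hx] at h1
    refine le_antisymm h1 ?_
    rcases h0.eq_or_lt with rfl | h0
    · rw [hT0]
      linarith
    · have hγ1 : ContDiffOn ℝ 1 γ (Set.Icc 0 t₁) := hγ.mono (Set.Icc_subset_Icc_right h12.le)
      have h2 := (hTm t₁ h0 (γ t₁)).2 ⟨γ, aux_lip_C1 h0 hγ1, rfl, rfl⟩
      rw [← intervalIntegral.integral_add_adjacent_intervals
        (aux_int_C1 hLc hTc le_rfl h0 hγ1) hi2] at hm
      linarith
end
end

section
/- Variational solutions are viscosity solutions (Lemma 4.3): Let L be a contact Lagrangian and define H(x,u,p) = sup_v (⟨p,v⟩ − L(x,u,v)). If u : ℝⁿ × [0,T] → ℝ is a continuous variational solution of the evolutionary equation w_t + H(x,w,w_x) = 0, then u is a viscosity solution of w_t + H(x,w,w_x) = 0 on ℝⁿ × (0,T). -/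
open Set Filter

noncomputable section

/-- Euclidean pairing `⟨v, w⟩ = ∑ i, v i * w i` on `ℝⁿ`. -/
def dotp (n : ℕ) (v w : Fin n → ℝ) : ℝ := ∑ i, v i * w i

/-- Componentwise partial gradient of `f : ℝⁿ → ℝ` at `p`. -/
def pgrad (n : ℕ) (f : (Fin n → ℝ) → ℝ) (p : Fin n → ℝ) : Fin n → ℝ :=
  fun i => deriv (fun s => f (Function.update p i s)) (p i)

/-- A contact Hamiltonian on `ℝⁿ` (flat torus) with Lipschitz constant `lam`:
`C²` regularity, `ℤⁿ`-periodicity in `x`, (H1) positive definiteness of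
`∂²H/∂p²`, (H2) superlinearity in `p`, and (H3) `|∂H/∂u| ≤ lam`. -/
def IsContactHamiltonian (n : ℕ) (lam : ℝ)
    (H : (Fin n → ℝ) → ℝ → (Fin n → ℝ) → ℝ) : Prop :=
  ContDiff ℝ 2 (fun q : (Fin n → ℝ) × ℝ × (Fin n → ℝ) => H q.1 q.2.1 q.2.2) ∧
  (∀ (x : Fin n → ℝ) (u : ℝ) (p : Fin n → ℝ) (k : Fin n → ℤ),
    H (fun i => x i + k i) u p = H x u p) ∧
  (∀ x u p (v : Fin n → ℝ), v ≠ 0 →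
    0 < iteratedFDeriv ℝ 2 (fun q => H x u q) p ![v, v]) ∧
  (∀ x u C, ∃ R : ℝ, ∀ p : Fin n → ℝ, R ≤ ‖p‖ → C * ‖p‖ ≤ H x u p) ∧
  0 < lam ∧
  (∀ x u p, |deriv (fun w => H x w p) u| ≤ lam)

/-- `(xc, uc, pc)` is a `C¹` solution of the contact Hamilton equations
`ẋ = ∂H/∂p`, `ṗ = -∂H/∂x - (∂H/∂u) p`, `u̇ = ⟨p, ∂H/∂p⟩ - H` on the set `S`. -/
def IsCHSolutionOn (n : ℕ) (H : (Fin n → ℝ) → ℝ → (Fin n → ℝ) → ℝ) (S : Set ℝ)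
    (xc : ℝ → Fin n → ℝ) (uc : ℝ → ℝ) (pc : ℝ → Fin n → ℝ) : Prop :=
  ContDiffOn ℝ 1 xc S ∧ ContDiffOn ℝ 1 uc S ∧ ContDiffOn ℝ 1 pc S ∧
  ∀ s ∈ S,
    derivWithin xc S s = pgrad n (fun p => H (xc s) (uc s) p) (pc s) ∧
    derivWithin pc S s =
      -pgrad n (fun y => H y (uc s) (pc s)) (xc s)
        - deriv (fun w => H (xc s) w (pc s)) (uc s) • pc s ∧
    derivWithin uc S s =
      dotp n (pc s) (pgrad n (fun p => H (xc s) (uc s) p) (pc s))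
        - H (xc s) (uc s) (pc s)

/-- Viscosity subsolution of `w_t + H(x, w, w_x) = c` on a set
`S ⊆ ℝⁿ × ℝ` of space-time points. -/
def ViscositySubSolOn (n : ℕ) (H : (Fin n → ℝ) → ℝ → (Fin n → ℝ) → ℝ) (c : ℝ)
    (S : Set ((Fin n → ℝ) × ℝ)) (u : (Fin n → ℝ) → ℝ → ℝ) : Prop :=
  ∀ φ : (Fin n → ℝ) → ℝ → ℝ,
    ContDiff ℝ 1 (fun q : (Fin n → ℝ) × ℝ => φ q.1 q.2) →
    ∀ (x₀ : Fin n → ℝ) (t₀ : ℝ), (x₀, t₀) ∈ S →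
      IsLocalMaxOn (fun q : (Fin n → ℝ) × ℝ => u q.1 q.2 - φ q.1 q.2) S (x₀, t₀) →
      deriv (fun s => φ x₀ s) t₀
        + H x₀ (u x₀ t₀) (pgrad n (fun y => φ y t₀) x₀) ≤ c

/-- Viscosity supersolution of `w_t + H(x, w, w_x) = c` on a set
`S ⊆ ℝⁿ × ℝ` of space-time points. -/
def ViscositySuperSolOn (n : ℕ) (H : (Fin n → ℝ) → ℝ → (Fin n → ℝ) → ℝ) (c : ℝ)
    (S : Set ((Fin n → ℝ) × ℝ)) (u : (Fin n → ℝ) → ℝ → ℝ) : Prop :=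
  ∀ ψ : (Fin n → ℝ) → ℝ → ℝ,
    ContDiff ℝ 1 (fun q : (Fin n → ℝ) × ℝ => ψ q.1 q.2) →
    ∀ (y₀ : Fin n → ℝ) (s₀ : ℝ), (y₀, s₀) ∈ S →
      IsLocalMinOn (fun q : (Fin n → ℝ) × ℝ => u q.1 q.2 - ψ q.1 q.2) S (y₀, s₀) →
      c ≤ deriv (fun s => ψ y₀ s) s₀
        + H y₀ (u y₀ s₀) (pgrad n (fun y => ψ y s₀) y₀)

/-- Viscosity solution of `w_t + H(x, w, w_x) = c` on `S`. -/
def ViscositySolOn (n : ℕ) (H : (Fin n → ℝ) → ℝ → (Fin n → ℝ) → ℝ) (c : ℝ)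
    (S : Set ((Fin n → ℝ) × ℝ)) (u : (Fin n → ℝ) → ℝ → ℝ) : Prop :=
  ViscositySubSolOn n H c S u ∧ ViscositySuperSolOn n H c S u

/-- A variational solution of `w_t + H(x, w, w_x) = 0` on `ℝⁿ × [0, T']`,
where `H` is the Hamiltonian associated with the contact Lagrangian `L`:
(i) along every continuous piecewise `C¹` curve the increment of `u` is at
most the Lagrangian action; (ii) for all `0 ≤ t₁ < t₂ ≤ T'` and every `x`
there is a calibrated `C¹` curve ending at `x`. -/
def VariationalSolution (n : ℕ) (L : (Fin n → ℝ) → ℝ → (Fin n → ℝ) → ℝ)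
    (T' : ℝ) (u : (Fin n → ℝ) → ℝ → ℝ) : Prop :=
  (∀ (t₁ t₂ : ℝ) (γ : ℝ → Fin n → ℝ), 0 ≤ t₁ → t₁ < t₂ → t₂ ≤ T' →
    PiecewiseC1On n γ t₁ t₂ →
    u (γ t₂) t₂ - u (γ t₁) t₁ ≤
      ∫ s in t₁..t₂, L (γ s) (u (γ s) s) (deriv γ s)) ∧
  (∀ (t₁ t₂ : ℝ) (x : Fin n → ℝ), 0 ≤ t₁ → t₁ < t₂ → t₂ ≤ T' →
    ∃ γ : ℝ → Fin n → ℝ, ContDiffOn ℝ 1 γ (Set.Icc t₁ t₂) ∧ γ t₂ = x ∧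
      u x t₂ - u (γ t₁) t₁ =
        ∫ s in t₁..t₂, L (γ s) (u (γ s) s) (deriv γ s))

theorem aux_slope {k : ℝ → ℝ} {k' a t : ℝ} (hat : a < t)
    (hk : HasDerivWithinAt k k' (Set.Icc a t) t)
    (h : ∀ᶠ s in nhdsWithin t (Set.Icc a t), k t ≤ k s) : k' ≤ 0 := by
  have hk2 : HasDerivWithinAt k k' (Set.Ico a t) t := hk.mono Set.Ico_subset_Icc_self
  rw [hasDerivWithinAt_iff_tendsto_slope' (by simp)] at hk2
  have : (nhdsWithin t (Set.Ico a t)).NeBot := by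
    rw [nhdsWithin_Ico_eq_nhdsLT hat]; infer_instance
  refine le_of_tendsto hk2 ?_
  have h2 : ∀ᶠ s in nhdsWithin t (Set.Ico a t), k t ≤ k s :=
    h.filter_mono (nhdsWithin_mono _ Set.Ico_subset_Icc_self)
  filter_upwards [h2, self_mem_nhdsWithin] with s hs hs2
  rw [slope_def_field]
  exact div_nonpos_of_nonneg_of_nonpos (by linarith) (by linarith [hs2.2])

theorem aux_int {l : ℝ → ℝ} {a t : ℝ} (hat : a < t) (hl : ContinuousOn l (Set.Icc a t)) :
    HasDerivWithinAt (fun s => ∫ x in s..t, l x) (-l t) (Set.Icc a t) t := by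
  have hc : Continuous (Set.IccExtend hat.le ((Set.Icc a t).domRestrict l)) :=
    (continuousOn_iff_continuous_domRestrict.1 hl).Icc_extend'
  have he : ∀ x ∈ Set.Icc a t, Set.IccExtend hat.le ((Set.Icc a t).domRestrict l) x = l x := by
    intro x hx
    rw [Set.IccExtend_of_mem _ _ hx]; rfl
  have h1 := (intervalIntegral.integral_hasDerivAt_left
    (hc.intervalIntegrable t t) (hc.stronglyMeasurableAtFilter _ _)
    hc.continuousAt).hasDerivWithinAt (s := Set.Icc a t)
  rw [he t ⟨hat.le, le_rfl⟩] at h1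
  refine h1.congr_of_mem ?_ ⟨hat.le, le_rfl⟩
  intro s hs
  refine intervalIntegral.integral_congr ?_
  intro x hx
  rw [Set.uIcc_of_le hs.2] at hx
  exact (he x ⟨hs.1.trans hx.1, hx.2⟩).symm

theorem aux_deriv (n : ℕ) (φ : (Fin n → ℝ) → ℝ → ℝ)
    (hφ : ContDiff ℝ 1 (fun q : (Fin n → ℝ) × ℝ => φ q.1 q.2))
    (γ : ℝ → Fin n → ℝ) (v : Fin n → ℝ) (S : Set ℝ) (t : ℝ)
    (hγ : HasDerivWithinAt γ v S t) :
    HasDerivWithinAt (fun s => φ (γ s) s)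
      (deriv (fun s => φ (γ t) s) t + dotp n (pgrad n (fun y => φ y t) (γ t)) v) S t := by
  have hd : HasFDerivAt (fun q : (Fin n → ℝ) × ℝ => φ q.1 q.2)
      (fderiv ℝ (fun q : (Fin n → ℝ) × ℝ => φ q.1 q.2) (γ t, t)) (γ t, t) :=
    (hφ.differentiable (by norm_num) _).hasFDerivAt
  set D := fderiv ℝ (fun q : (Fin n → ℝ) × ℝ => φ q.1 q.2) (γ t, t)
  have h1 : deriv (fun s => φ (γ t) s) t = D (0, 1) := by
    have : HasDerivAt (fun s : ℝ => ((γ t, s) : (Fin n → ℝ) × ℝ)) (0, 1) t :=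
      (hasDerivAt_const t (γ t)).prodMk (hasDerivAt_id t)
    exact (hd.comp_hasDerivAt t this).deriv
  have h2 : ∀ i, pgrad n (fun y => φ y t) (γ t) i = D (Pi.single i 1, 0) := by
    intro i
    have : HasDerivAt (fun s : ℝ => ((Function.update (γ t) i s, t) : (Fin n → ℝ) × ℝ))
        (Pi.single i 1, 0) (γ t i) :=
      (hasDerivAt_update (γ t) i (γ t i)).prodMk (hasDerivAt_const _ t)
    exact (HasFDerivAt.comp_hasDerivAt_of_eq (γ t i) hd this (by simp)).deriv
  have h3 : D (v, 1) = deriv (fun s => φ (γ t) s) t + dotp n (pgrad n (fun y => φ y t) (γ t)) v := by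
    rw [h1]
    have hv : ((v, 1) : (Fin n → ℝ) × ℝ) =
        (0, 1) + ∑ i, v i • ((Pi.single i 1, 0) : (Fin n → ℝ) × ℝ) := by
      refine Prod.ext ?_ ?_
      · simp only [Prod.fst_add, Prod.fst_sum, Prod.smul_fst, zero_add]
        exact pi_eq_sum_univ' v
      · simp [Prod.snd_sum]
    rw [hv, map_add, map_sum]
    unfold dotp
    congr 1
    refine Finset.sum_congr rfl fun i _ => ?_
    rw [h2, map_smul, smul_eq_mul, mul_comm]
  rw [← h3]
  have : HasDerivWithinAt (fun s : ℝ => ((γ s, s) : (Fin n → ℝ) × ℝ)) (v, 1) S t :=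
    hγ.prodMk (hasDerivWithinAt_id t S)
  exact HasFDerivAt.comp_hasDerivWithinAt_of_eq t hd this rfl

theorem aux_cont (n : ℕ) (L : (Fin n → ℝ) → ℝ → (Fin n → ℝ) → ℝ)
    (hL : Continuous (fun q : (Fin n → ℝ) × ℝ × (Fin n → ℝ) => L q.1 q.2.1 q.2.2))
    (T' : ℝ) (u : (Fin n → ℝ) → ℝ → ℝ)
    (hu : ContinuousOn (fun q : (Fin n → ℝ) × ℝ => u q.1 q.2)
      (Set.univ ×ˢ Set.Icc 0 T')) (t : ℝ) (ht0 : 0 < t) (ht : t ≤ T')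
    (γ : ℝ → Fin n → ℝ) (hγ : ContDiffOn ℝ 1 γ (Set.Icc 0 t)) :
    ContinuousOn (fun s => L (γ s) (u (γ s) s) (derivWithin γ (Set.Icc 0 t) s))
      (Set.Icc 0 t) := by
  have h1 : ContinuousOn (fun s => ((γ s, s) : (Fin n → ℝ) × ℝ)) (Set.Icc 0 t) :=
    hγ.continuousOn.prodMk continuousOn_id
  have h2 : ContinuousOn (fun s => u (γ s) s) (Set.Icc 0 t) :=
    hu.comp h1 (fun s hs => ⟨trivial, hs.1, hs.2.trans ht⟩)
  have h3 := hγ.continuousOn_derivWithin (uniqueDiffOn_Icc ht0) le_rfl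
  exact hL.comp_continuousOn (hγ.continuousOn.prodMk (h2.prodMk h3))

theorem aux_eq (n : ℕ) (L : (Fin n → ℝ) → ℝ → (Fin n → ℝ) → ℝ)
    (u : (Fin n → ℝ) → ℝ → ℝ) (t : ℝ) (γ : ℝ → Fin n → ℝ) (a b : ℝ)
    (ha : 0 ≤ a) (hab : a ≤ b) (hb : b ≤ t) :
    (∫ s in a..b, L (γ s) (u (γ s) s) (deriv γ s)) =
    ∫ s in a..b, L (γ s) (u (γ s) s) (derivWithin γ (Set.Icc 0 t) s) := by
  rw [intervalIntegral.integral_of_le hab, intervalIntegral.integral_of_le hab,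
    MeasureTheory.integral_Ioc_eq_integral_Ioo, MeasureTheory.integral_Ioc_eq_integral_Ioo]
  refine MeasureTheory.setIntegral_congr_fun measurableSet_Ioo ?_
  intro s hs
  simp only
  rw [derivWithin_of_mem_nhds (Icc_mem_nhds (ha.trans_lt hs.1) (hs.2.trans_le hb))]

theorem aux_pw_s10 (n : ℕ) (γ : ℝ → Fin n → ℝ) (a b : ℝ) (hab : a < b)
    (h : ContDiffOn ℝ 1 γ (Set.Icc a b)) : PiecewiseC1On n γ a b := by
  refine ⟨h.continuousOn, 1, ![a, b], ?_, rfl, rfl, ?_⟩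
  · intro i j hij
    fin_cases i <;> fin_cases j <;> simp_all
  · intro j
    fin_cases j
    simpa using h

/-- **Variational solutions are viscosity solutions (Lemma 4.3).**
Let `L` be a contact Lagrangian and `H(x,u,p) = sup_v (⟨p,v⟩ - L(x,u,v))`.
If `u : ℝⁿ × [0,T'] → ℝ` is a continuous variational solution of
`w_t + H(x,w,w_x) = 0`, then `u` is a viscosity solution of
`w_t + H(x,w,w_x) = 0` on `ℝⁿ × (0,T')`. -/
theorem variational_implies_viscosity
    (n : ℕ) (hn : 1 ≤ n) (lam : ℝ)
    (L H : (Fin n → ℝ) → ℝ → (Fin n → ℝ) → ℝ)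
    (hL : IsContactLagrangian n lam L)
    (hHL : ∀ x u p, IsLUB {A : ℝ | ∃ v, A = dotp n p v - L x u v} (H x u p))
    (T' : ℝ) (hT' : 0 < T')
    (u : (Fin n → ℝ) → ℝ → ℝ)
    (hu : ContinuousOn (fun q : (Fin n → ℝ) × ℝ => u q.1 q.2)
      (Set.univ ×ˢ Set.Icc 0 T'))
    (hvar : VariationalSolution n L T' u) :
    ViscositySolOn n H 0 (Set.univ ×ˢ Set.Ioo 0 T') u := by
  have hev : ∀ (P : (Fin n → ℝ) × ℝ → Prop) (γ : ℝ → Fin n → ℝ) (t : ℝ), 0 < t → t < T' →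
      ContinuousOn γ (Set.Icc 0 t) →
      (∀ᶠ q in nhdsWithin (γ t, t) (Set.univ ×ˢ Set.Ioo 0 T'), P q) →
      ∀ᶠ s in nhdsWithin t (Set.Icc 0 t), P (γ s, s) := by
    intro P γ t h0 hT hγ hP
    have ho : (Set.univ ×ˢ Set.Ioo 0 T' : Set ((Fin n → ℝ) × ℝ)) ∈ nhds (γ t, t) :=
      (isOpen_univ.prod isOpen_Ioo).mem_nhds ⟨trivial, h0, hT⟩
    rw [nhdsWithin_eq_nhds.2 ho] at hP
    have hc : ContinuousWithinAt (fun s => ((γ s, s) : (Fin n → ℝ) × ℝ)) (Set.Icc 0 t) t :=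
      (hγ t ⟨h0.le, le_rfl⟩).prodMk continuousWithinAt_id
    exact hc.eventually hP
  constructor
  · intro φ hφ x t hS hmax
    obtain ⟨-, h0, hT⟩ := hS
    simp only at h0 hT
    have key : H x (u x t) (pgrad n (fun y => φ y t) x) ≤ - deriv (fun s => φ x s) t := by
      refine (hHL _ _ _).2 ?_
      rintro A ⟨v, rfl⟩
      let γ : ℝ → Fin n → ℝ := fun s => x + (s - t) • v
      have hγt : γ t = x := by simp [γ]
      have hγC : ContDiff ℝ 1 γ := by
        simp only [γ]; fun_prop
      have hγd : HasDerivWithinAt γ v (Set.Icc 0 t) t := by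
        have := (((hasDerivAt_id t).sub_const t).smul_const v).const_add x
        simpa [γ] using this.hasDerivWithinAt (s := Set.Icc 0 t)
      have hv : derivWithin γ (Set.Icc 0 t) t = v :=
        hγd.derivWithin (uniqueDiffOn_Icc h0 t ⟨h0.le, le_rfl⟩)
      have hg := aux_deriv n φ hφ γ v _ t hγd
      have hI := aux_int h0 (aux_cont n L hL.1 T' u hu t h0 hT.le γ hγC.contDiffOn)
      have := aux_slope h0 (hg.add hI) ?_
      · rw [hv, hγt] at this
        linarith
      · have hm := hev _ γ t h0 hT hγC.continuous.continuousOn (by rw [hγt]; exact hmax)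
        filter_upwards [hm, self_mem_nhdsWithin] with s hs hsI
        simp only [Pi.add_apply, intervalIntegral.integral_same, hγt] at hs ⊢
        rcases hsI.2.eq_or_lt with rfl | hlt
        · simp [hγt]
        · have := hvar.1 s t γ hsI.1 hlt hT.le (aux_pw_s10 n γ s t hlt hγC.contDiffOn)
          rw [aux_eq n L u t γ s t hsI.1 hsI.2 le_rfl, hγt] at this
          linarith
    linarith
  · intro φ hφ x t hS hmin
    obtain ⟨-, h0, hT⟩ := hS
    simp only at h0 hT
    obtain ⟨γ, hγC, hγt, hcal⟩ := hvar.2 0 t x le_rfl h0 hT.le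
    have htI : t ∈ Set.Icc 0 t := ⟨h0.le, le_rfl⟩
    have hγd := (hγC.differentiableOn (by norm_num) t htI).hasDerivWithinAt
    set v := derivWithin γ (Set.Icc 0 t) t with hv
    have hg := aux_deriv n φ hφ γ v _ t hγd
    have hc := aux_cont n L hL.1 T' u hu t h0 hT.le γ hγC
    have hI := aux_int h0 hc
    have := aux_slope h0 (hg.add hI).neg ?_
    · rw [hγt] at this
      have hle := (hHL x (u x t) (pgrad n (fun y => φ y t) x)).1 ⟨v, rfl⟩
      rw [← hv] at this
      linarith
    · have hm := hev _ γ t h0 hT hγC.continuousOn (by rw [hγt]; exact hmin)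
      filter_upwards [hm, self_mem_nhdsWithin] with s hs hsI
      simp only [Pi.neg_apply, Pi.add_apply, intervalIntegral.integral_same, hγt] at hs ⊢
      rw [aux_eq n L u t γ 0 t le_rfl h0.le le_rfl] at hcal
      rcases hsI.1.eq_or_lt with rfl | hlt
      · linarith
      · have h1 := hvar.1 0 s γ le_rfl hlt (hsI.2.trans hT.le)
          (aux_pw_s10 n γ 0 s hlt (hγC.mono (Set.Icc_subset_Icc_right hsI.2)))
        rw [aux_eq n L u t γ 0 s le_rfl hsI.1 hsI.2] at h1
        have hadd := intervalIntegral.integral_add_adjacent_intervals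
          ((hc.mono (Set.Icc_subset_Icc_right hsI.2)).intervalIntegrable_of_Icc
            (μ := MeasureTheory.volume) hsI.1)
          ((hc.mono (Set.Icc_subset_Icc_left hsI.1)).intervalIntegrable_of_Icc
            (μ := MeasureTheory.volume) hsI.2)
        linarith
end
end

section
/- Comparison of T^c_1φ with φ for large |c| (Lemma 5.1): Let L be a contact Lagrangian and, for each c ∈ ℝ, let T^c_t be the backward solution semigroup for L + c, with the stated calibration along minimizers. Then for each ℤⁿ-periodic φ ∈ C(ℝⁿ,ℝ) there exists c̃ > 0 such that: (i) T^c_1φ(x) ≥ φ(x) for all x ∈ ℝⁿ whenever c ≥ c̃; (ii) T^c_1φ(x) ≤ φ(x) for all x ∈ ℝⁿ whenever c ≤ −c̃. -/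
open Set Filter

noncomputable section

open MeasureTheory

lemma aux_gronwall (lam : ℝ) (hlam : 0 < lam) (d : ℝ → ℝ) (hd : ContinuousOn d (Icc 0 1))
    (h0 : d 0 ≤ 0)
    (H : ∀ s t M, 0 ≤ s → s ≤ t → t ≤ 1 → (∀ τ ∈ Icc s t, 0 ≤ d τ ∧ d τ ≤ M) → d s = 0 →
      d t ≤ lam * M * (t - s)) : d 1 ≤ 0 := by
  by_contra hc
  push Not at hc
  have hS : IsCompact (Icc (0:ℝ) 1 ∩ d ⁻¹' Iic 0) :=
    isCompact_Icc.of_isClosed_subset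
      (hd.preimage_isClosed_of_isClosed isClosed_Icc isClosed_Iic) inter_subset_left
  obtain ⟨s, ⟨hs, hsd⟩, hmax⟩ := hS.exists_isGreatest ⟨0, ⟨le_refl _, zero_le_one⟩, h0⟩
  simp only [mem_preimage, mem_Iic] at hsd
  have hs1 : s < 1 := lt_of_le_of_ne hs.2 (by rintro rfl; linarith)
  have hpos : ∀ τ, s < τ → τ ≤ 1 → 0 < d τ := by
    intro τ h1 h2
    by_contra h3
    push Not at h3
    have := hmax ⟨⟨hs.1.trans h1.le, h2⟩, h3⟩
    linarith
  have hs0 : d s = 0 := by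
    obtain ⟨r, hr, hr0⟩ := intermediate_value_Icc hs.2 (hd.mono (Icc_subset_Icc_left hs.1))
      (show (0:ℝ) ∈ Icc (d s) (d 1) from ⟨hsd, hc.le⟩)
    rcases eq_or_lt_of_le hr.1 with h | h
    · rw [h]; exact hr0
    · have := hpos r h hr.2; linarith
  set t := min 1 (s + 1 / (2 * lam)) with ht
  have hst : s < t := lt_min hs1 (by have : 0 < 1 / (2 * lam) := by positivity
                                     linarith)
  have ht1 : t ≤ 1 := min_le_left _ _
  obtain ⟨p, hp, hpm⟩ := isCompact_Icc.exists_isMaxOn (nonempty_Icc.2 hst.le)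
    (hd.mono (Icc_subset_Icc hs.1 ht1))
  have hM : 0 < d p := lt_of_lt_of_le (hpos t hst ht1) (hpm (right_mem_Icc.2 hst.le))
  have h1 := H s p (d p) hs.1 hp.1 (hp.2.trans ht1) (fun τ hτ => ⟨by
    rcases eq_or_lt_of_le hτ.1 with h | h
    · rw [← h, hs0]
    · exact (hpos τ h (hτ.2.trans (hp.2.trans ht1))).le, hpm ⟨hτ.1, hτ.2.trans hp.2⟩⟩) hs0
  have h2 : p - s ≤ 1 / (2 * lam) := by
    have := hp.2.trans (min_le_right 1 (s + 1 / (2 * lam)))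
    linarith
  have h3 : lam * d p * (p - s) ≤ lam * d p * (1 / (2 * lam)) := by gcongr
  have h4 : lam * d p * (1 / (2 * lam)) = d p / 2 := by field_simp
  linarith

lemma aux_fract {n : ℕ} (x : Fin n → ℝ) : ∃ y ∈ Icc (0 : Fin n → ℝ) 1, ∃ k : Fin n → ℤ,
    x = fun i => y i + k i :=
  ⟨fun i => Int.fract (x i), ⟨fun i => Int.fract_nonneg _, fun i => (Int.fract_lt_one _).le⟩,
    fun i => ⌊x i⌋, by ext i; simp⟩

lemma aux_bdd {n : ℕ} {f : (Fin n → ℝ) → ℝ} (hf : PerCont n f) : ∃ N, 0 < N ∧ ∀ x, |f x| ≤ N := by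
  obtain ⟨N, hN⟩ := (isCompact_Icc (a := (0 : Fin n → ℝ)) (b := 1)).exists_bound_of_continuousOn
    hf.1.continuousOn
  refine ⟨max N 1, by positivity, fun x => ?_⟩
  obtain ⟨y, hy, k, rfl⟩ := aux_fract x
  rw [hf.2]
  exact (hN y hy).trans (le_max_left _ _)

lemma aux_lower {n : ℕ} {lam : ℝ} {L : (Fin n → ℝ) → ℝ → (Fin n → ℝ) → ℝ}
    (hL : IsContactLagrangian n lam L) : ∃ B, ∀ x v, -B ≤ L x 0 v := by
  obtain ⟨hc, hper, hconv, hsup, -, -⟩ := hL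
  have hc0 : Continuous (fun q : (Fin n → ℝ) × (Fin n → ℝ) => L q.1 0 q.2) :=
    hc.comp (f := fun q : (Fin n → ℝ) × (Fin n → ℝ) => (q.1, (0:ℝ), q.2)) (by fun_prop)
  have hc1 : Continuous (fun q : (Fin n → ℝ) × (Fin n → ℝ) => L q.1 0 0) :=
    hc.comp (f := fun q : (Fin n → ℝ) × (Fin n → ℝ) => (q.1, (0:ℝ), (0 : Fin n → ℝ)))
      (by fun_prop)
  have key : ∃ B, ∀ x ∈ Icc (0 : Fin n → ℝ) 1, ∀ v, -B ≤ L x 0 v := by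
    refine IsCompact.induction_on (p := fun s => ∃ B, ∀ x ∈ s, ∀ v, -B ≤ L x 0 v)
      (isCompact_Icc (a := (0 : Fin n → ℝ)) (b := 1)) ⟨0, by simp⟩ ?_ ?_ ?_
    · rintro s t hst ⟨B, hB⟩
      exact ⟨B, fun x hx => hB x (hst hx)⟩
    · rintro s t ⟨B, hB⟩ ⟨B', hB'⟩
      refine ⟨max B B', ?_⟩
      rintro x (hx | hx) v
      · have := hB x hx v
        have := le_max_left B B'
        linarith
      · have := hB' x hx v
        have := le_max_right B B'
        linarith
    · intro x₀ _
      obtain ⟨R0, hR0⟩ := hsup x₀ 0 1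
      set R := max (max R0 (L x₀ 0 0 + 1)) 1 with hR
      have hR1 : 1 ≤ R := le_max_right _ _
      have hR2 : R0 ≤ R := (le_max_left _ _).trans (le_max_left _ _)
      have hR3 : L x₀ 0 0 + 1 ≤ R := (le_max_right _ _).trans (le_max_left _ _)
      obtain ⟨b, hb⟩ := (isCompact_closedBall (0 : Fin n → ℝ) R).exists_bound_of_continuousOn
        (f := fun v => L x₀ 0 v)
        (hc0.comp (f := fun v : Fin n → ℝ => (x₀, v)) (by fun_prop)).continuousOn
      obtain ⟨U, V, hU, -, hxU, hV, hUV⟩ := generalized_tube_lemma (isCompact_singleton (x := x₀))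
        (isCompact_sphere (0 : Fin n → ℝ) R) (isOpen_lt hc1 hc0) (by
          rintro ⟨x, v⟩ ⟨hx, hv⟩
          simp only [mem_singleton_iff] at hx
          subst hx
          simp only [mem_sphere_iff_norm, sub_zero] at hv
          have := hR0 v (by rw [hv]; exact hR2)
          simp only [mem_setOf_eq]
          linarith)
      obtain ⟨U', V', hU', -, hxU', hV', hUV'⟩ := generalized_tube_lemma
        (isCompact_singleton (x := x₀))
        (isCompact_closedBall (0 : Fin n → ℝ) R)
        (isOpen_lt (continuous_const (y := -(b+1))) hc0) (by
          rintro ⟨x, v⟩ ⟨hx, hv⟩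
          simp only [mem_singleton_iff] at hx
          subst hx
          have := hb v hv
          have := neg_le_of_abs_le this
          simp only [mem_setOf_eq]
          linarith)
      refine ⟨U ∩ U', mem_nhdsWithin_of_mem_nhds (inter_mem (hU.mem_nhds (hxU rfl))
        (hU'.mem_nhds (hxU' rfl))), b + 1, ?_⟩
      rintro x ⟨hx, hx'⟩ v
      have hball : ∀ w ∈ Metric.closedBall (0 : Fin n → ℝ) R, -(b+1) < L x 0 w := fun w hw =>
        hUV' (show (x, w) ∈ U' ×ˢ V' from ⟨hx', hV' hw⟩)
      by_cases hv : ‖v‖ ≤ R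
      · exact (hball v (by simpa using hv)).le
      · push Not at hv
        have hvpos : 0 < ‖v‖ := by linarith
        have h1 : L x 0 0 < L x 0 ((R / ‖v‖) • v) :=
          hUV (show (x, (R / ‖v‖) • v) ∈ U ×ˢ V from ⟨hx, hV (by
            rw [mem_sphere_iff_norm, sub_zero, norm_smul, Real.norm_of_nonneg (by positivity)]
            field_simp)⟩)
        have h2 := (hconv x 0).convexOn.2 (mem_univ (0 : Fin n → ℝ)) (mem_univ v)
          (show 0 ≤ 1 - R / ‖v‖ by
            have := (div_le_one hvpos).2 hv.le
            linarith) (show 0 ≤ R / ‖v‖ by positivity) (by ring)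
        simp only [smul_zero, zero_add, smul_eq_mul] at h2
        have h3 := hball 0 (by simp; linarith)
        have h4 : 0 < R / ‖v‖ := by positivity
        have h5 : (R / ‖v‖) * L x 0 0 < (R / ‖v‖) * L x 0 v := by linarith
        have := lt_of_mul_lt_mul_left h5 h4.le
        linarith
  obtain ⟨B, hB⟩ := key
  refine ⟨B, fun x v => ?_⟩
  obtain ⟨y, hy, k, rfl⟩ := aux_fract x
  rw [hper]
  exact hB y hy v

lemma aux_int_s14 {n : ℕ} {L : (Fin n → ℝ) → ℝ → (Fin n → ℝ) → ℝ}
    (hc : Continuous (fun q : (Fin n → ℝ) × ℝ × (Fin n → ℝ) => L q.1 q.2.1 q.2.2))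
    {t : ℝ} (ht : 0 ≤ t) {γ : ℝ → Fin n → ℝ} {K : NNReal} (hγ : LipschitzOnWith K γ (Icc 0 t))
    {w : ℝ → ℝ} (hw : ContinuousOn w (Icc 0 t)) :
    IntervalIntegrable (fun τ => L (γ τ) (w τ) (deriv γ τ)) volume 0 t := by
  rw [intervalIntegrable_iff_integrableOn_Ioo_of_le ht]
  have hγc := hγ.continuousOn
  have hder : ∀ τ ∈ Ioo 0 t, deriv γ τ ∈ Metric.closedBall (0 : Fin n → ℝ) K := by
    intro τ hτ
    have := norm_deriv_le_of_lipschitzOn (Icc_mem_nhds hτ.1 hτ.2) hγ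
    simpa using this
  have hcomp : IsCompact ((γ '' Icc 0 t) ×ˢ (w '' Icc 0 t) ×ˢ
      Metric.closedBall (0 : Fin n → ℝ) K) :=
    (isCompact_Icc.image_of_continuousOn hγc).prod
      ((isCompact_Icc.image_of_continuousOn hw).prod (isCompact_closedBall _ _))
  obtain ⟨b, hb⟩ := hcomp.exists_bound_of_continuousOn hc.continuousOn
  have hm1 : AEStronglyMeasurable γ (volume.restrict (Ioo 0 t)) :=
    (hγc.mono Ioo_subset_Icc_self).aestronglyMeasurable measurableSet_Ioo
  have hm2 : AEStronglyMeasurable w (volume.restrict (Ioo 0 t)) :=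
    (hw.mono Ioo_subset_Icc_self).aestronglyMeasurable measurableSet_Ioo
  have hm3 : AEStronglyMeasurable (deriv γ) (volume.restrict (Ioo 0 t)) :=
    (measurable_deriv γ).aestronglyMeasurable
  refine IntegrableOn.of_bound (C := b) (by simp) 
    (hc.comp_aestronglyMeasurable (hm1.prodMk (hm2.prodMk hm3))) ?_
  filter_upwards [ae_restrict_mem measurableSet_Ioo] with τ hτ
  exact hb (γ τ, w τ, deriv γ τ) ⟨mem_image_of_mem _ (Ioo_subset_Icc_self hτ),
    mem_image_of_mem _ (Ioo_subset_Icc_self hτ), hder τ hτ⟩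

lemma aux_T {n : ℕ} {L : (Fin n → ℝ) → ℝ → (Fin n → ℝ) → ℝ} {φ : (Fin n → ℝ) → ℝ}
    {T : ℝ → (Fin n → ℝ) → ℝ} (hT : BackwardSemigroup n L φ T) {t : ℝ} {γ : ℝ → Fin n → ℝ}
    (hγ : ContinuousOn γ (Icc 0 t)) : ContinuousOn (fun τ => T τ (γ τ)) (Icc 0 t) :=
  hT.1.comp (f := fun τ => (γ τ, τ)) (hγ.prodMk continuousOn_id) (fun τ hτ => ⟨trivial, hτ.1⟩)

/-- semigroup inequality along the constant curve -/
lemma aux_const {n : ℕ} {L : (Fin n → ℝ) → ℝ → (Fin n → ℝ) → ℝ} {φ : (Fin n → ℝ) → ℝ}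
    (hc : Continuous (fun q : (Fin n → ℝ) × ℝ × (Fin n → ℝ) => L q.1 q.2.1 q.2.2))
    {T : ℝ → (Fin n → ℝ) → ℝ} (hT : BackwardSemigroup n L φ T) {s t : ℝ} (hs : 0 ≤ s)
    (hst : s ≤ t) (x : Fin n → ℝ) :
    T t x ≤ T s x + ∫ τ in s..t, L x (T τ x) 0 := by
  rcases eq_or_lt_of_le hst with rfl | hst
  · simp
  obtain ⟨γ, ⟨K, hK⟩, hγs, hval⟩ : ∃ γ : ℝ → Fin n → ℝ,
      (∃ K : NNReal, LipschitzOnWith K γ (Set.Icc 0 s)) ∧ γ s = x ∧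
      T s x = φ (γ 0) + ∫ τ in (0:ℝ)..s, L (γ τ) (T τ (γ τ)) (deriv γ τ) := by
    rcases eq_or_lt_of_le hs with rfl | hs
    · exact ⟨fun _ => x, ⟨0, (LipschitzWith.const x).lipschitzOnWith⟩, rfl, by simp [hT.2.2.1]⟩
    · exact (hT.2.2.2 s hs x).1
  set η : ℝ → Fin n → ℝ := fun τ => γ (min τ s) with hη
  have hηL : LipschitzOnWith (K * 1) η (Icc 0 t) :=
    hK.comp (f := fun τ => min τ s) (LipschitzWith.id.min_const s).lipschitzOnWith
      (fun τ hτ => ⟨le_min hτ.1 hs, min_le_right _ _⟩)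
  have hle := (hT.2.2.2 t (hs.trans_lt hst) x).2
    ⟨η, ⟨_, hηL⟩, by simp [hη, min_eq_right hst.le, hγs], rfl⟩
  have hint := aux_int_s14 hc (hs.trans hst.le) hηL (aux_T hT hηL.continuousOn)
  have hmem : s ∈ uIcc 0 t := by rw [uIcc_of_le (hs.trans hst.le)]; exact ⟨hs, hst.le⟩
  rw [← intervalIntegral.integral_add_adjacent_intervals
    (hint.mono_set (uIcc_subset_uIcc_left hmem)) (hint.mono_set (uIcc_subset_uIcc_right hmem))] at hle
  have e1 : ∫ τ in (0:ℝ)..s, L (η τ) (T τ (η τ)) (deriv η τ)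
      = ∫ τ in (0:ℝ)..s, L (γ τ) (T τ (γ τ)) (deriv γ τ) := by
    rw [intervalIntegral.integral_of_le hs, intervalIntegral.integral_of_le hs,
      integral_Ioc_eq_integral_Ioo, integral_Ioc_eq_integral_Ioo]
    refine setIntegral_congr_fun measurableSet_Ioo (fun τ hτ => ?_)
    have : η =ᶠ[nhds τ] γ := by
      filter_upwards [Iio_mem_nhds hτ.2] with r hr
      simp only [hη, min_eq_left (le_of_lt (mem_Iio.1 hr))]
    simp only [this.deriv_eq, this.eq_of_nhds]
  have e2 : ∫ τ in s..t, L (η τ) (T τ (η τ)) (deriv η τ) = ∫ τ in s..t, L x (T τ x) 0 := by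
    rw [intervalIntegral.integral_of_le hst.le, intervalIntegral.integral_of_le hst.le]
    refine setIntegral_congr_fun measurableSet_Ioc (fun τ hτ => ?_)
    have : η =ᶠ[nhds τ] fun _ => x := by
      filter_upwards [Ioi_mem_nhds hτ.1] with r hr
      simp only [hη, min_eq_right (le_of_lt (mem_Ioi.1 hr)), hγs]
    simp only [this.deriv_eq, this.eq_of_nhds, deriv_const]
  have e0 : η 0 = γ 0 := by simp [hη, min_eq_left hs]
  rw [e1, e2, e0] at hle
  linarith

/-- **Comparison of `T^c_1 φ` with `φ` for large `|c|` (Lemma 5.1).**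
Let `L` be a contact Lagrangian and, for each `c ∈ ℝ`, let `Tc c` be the
backward solution semigroup for `L + c`, satisfying the calibration property
along minimizers.  Then for each `ℤⁿ`-periodic continuous `φ` there exists
`ct > 0` such that `T^c_1 φ ≥ φ` pointwise whenever `c ≥ ct`, and
`T^c_1 φ ≤ φ` pointwise whenever `c ≤ -ct`. -/
theorem comparison_large_c
    (n : ℕ) (hn : 1 ≤ n) (lam : ℝ)
    (L : (Fin n → ℝ) → ℝ → (Fin n → ℝ) → ℝ)
    (hL : IsContactLagrangian n lam L)
    (Tc : ℝ → ((Fin n → ℝ) → ℝ) → ℝ → (Fin n → ℝ) → ℝ)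
    (hTc : ∀ (c : ℝ) (ψ : (Fin n → ℝ) → ℝ), PerCont n ψ →
      BackwardSemigroup n (fun x u v => L x u v + c) ψ (Tc c ψ))
    (hcal : ∀ (c : ℝ) (ψ : (Fin n → ℝ) → ℝ), PerCont n ψ →
      ∀ (t : ℝ), 0 < t → ∀ (x : Fin n → ℝ) (γ : ℝ → Fin n → ℝ),
      (∃ K : NNReal, LipschitzOnWith K γ (Set.Icc 0 t)) → γ t = x →
      Tc c ψ t x =
        ψ (γ 0) + ∫ τ in (0:ℝ)..t, (L (γ τ) (Tc c ψ τ (γ τ)) (deriv γ τ) + c) →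
      ∀ s ∈ Set.Icc (0:ℝ) t,
        Tc c ψ s (γ s) =
          ψ (γ 0) + ∫ τ in (0:ℝ)..s, (L (γ τ) (Tc c ψ τ (γ τ)) (deriv γ τ) + c))
    (φ : (Fin n → ℝ) → ℝ) (hφ : PerCont n φ) :
    ∃ ct : ℝ, 0 < ct ∧
      (∀ c : ℝ, ct ≤ c → ∀ x : Fin n → ℝ, φ x ≤ Tc c φ 1 x) ∧
      (∀ c : ℝ, c ≤ -ct → ∀ x : Fin n → ℝ, Tc c φ 1 x ≤ φ x) := by
  obtain ⟨B, hB⟩ := aux_lower hL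
  obtain ⟨N, hN0, hN⟩ := aux_bdd hφ
  obtain ⟨hc, hper, -, -, hlam, hLip⟩ := hL
  obtain ⟨A, hA0, hA⟩ := aux_bdd (f := fun x => L x (φ x) 0)
    ⟨hc.comp (f := fun x : Fin n → ℝ => (x, φ x, (0 : Fin n → ℝ)))
      (by have := hφ.1; fun_prop), fun x k => by simp only [hφ.2, hper]⟩
  have hcc : ∀ c : ℝ, Continuous
      (fun q : (Fin n → ℝ) × ℝ × (Fin n → ℝ) => L q.1 q.2.1 q.2.2 + c) :=
    fun c => hc.add continuous_const
  refine ⟨max A (2 * N + B + lam * N), lt_max_of_lt_left hA0, ?_, ?_⟩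
  · intro c hcc' x
    have hc1 : 2 * N + B + lam * N ≤ c := (le_max_right _ _).trans hcc'
    have hT := hTc c φ hφ
    obtain ⟨γ, ⟨K, hK⟩, hγ1, hval⟩ := (hT.2.2.2 1 one_pos x).1
    have hcalγ := hcal c φ hφ 1 one_pos x γ ⟨K, hK⟩ hγ1 hval
    set u : ℝ → ℝ := fun τ => Tc c φ τ (γ τ) with hu
    have huc : ContinuousOn u (Icc 0 1) := aux_T hT hK.continuousOn
    have hint := aux_int_s14 (L := fun x u v => L x u v + c) (hcc c) zero_le_one hK huc
    have hd := aux_gronwall lam hlam (fun τ => -N + 2 * N * τ - u τ)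
      (by fun_prop) (by
        have := neg_le_of_abs_le (hN (γ 0))
        simp only [hu, hT.2.2.1]
        linarith) (by
        intro s t M hs hst ht hM hs0
        have hi0s : IntervalIntegrable (fun τ => L (γ τ) (u τ) (deriv γ τ) + c) volume 0 s :=
          hint.mono_set (by
            rw [uIcc_of_le hs, uIcc_of_le zero_le_one]; exact Icc_subset_Icc_right (hst.trans ht))
        have hist : IntervalIntegrable (fun τ => L (γ τ) (u τ) (deriv γ τ) + c) volume s t :=
          hint.mono_set (by
            rw [uIcc_of_le hst, uIcc_of_le zero_le_one]; exact Icc_subset_Icc hs ht)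
        have h1 : u s = φ (γ 0) + ∫ τ in (0:ℝ)..s, (L (γ τ) (u τ) (deriv γ τ) + c) :=
          hcalγ s ⟨hs, hst.trans ht⟩
        have h2 : u t = φ (γ 0) + ∫ τ in (0:ℝ)..t, (L (γ τ) (u τ) (deriv γ τ) + c) :=
          hcalγ t ⟨hs.trans hst, ht⟩
        rw [← intervalIntegral.integral_add_adjacent_intervals hi0s hist] at h2
        have h3 : ∫ τ in s..t, (2 * N - lam * M) ≤
            ∫ τ in s..t, (L (γ τ) (u τ) (deriv γ τ) + c) := by
          refine intervalIntegral.integral_mono_on hst (by simp) hist (fun τ hτ => ?_)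
          obtain ⟨g1, g2⟩ := hM τ hτ
          have g3 := hB (γ τ) (deriv γ τ)
          have g4 := neg_le_of_abs_le (hLip (γ τ) (deriv γ τ) (u τ) 0)
          rw [sub_zero] at g4
          have t0 : 0 ≤ τ := hs.trans hτ.1
          have t1 : τ ≤ 1 := hτ.2.trans ht
          have g5 : |u τ| ≤ N + M := by
            rw [abs_le]
            constructor <;> nlinarith
          have g6 : lam * |u τ| ≤ lam * (N + M) := by gcongr
          linarith
        rw [intervalIntegral.integral_const, smul_eq_mul] at h3
        linarith)
    have h1 := le_of_abs_le (hN x)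
    have h2 : u 1 = Tc c φ 1 x := by simp only [hu, hγ1]
    simp only [h2] at hd
    linarith
  · intro c hcc' x
    have hc1 : c ≤ -A := by
      have := le_max_left A (2 * N + B + lam * N)
      linarith
    have hT := hTc c φ hφ
    have huc : ContinuousOn (fun τ => Tc c φ τ x) (Icc 0 1) :=
      aux_T hT (γ := fun _ => x) continuousOn_const
    have hd := aux_gronwall lam hlam (fun τ => Tc c φ τ x - φ x)
      (huc.sub continuousOn_const) (by simp [hT.2.2.1]) (by
        intro s t M hs hst ht hM hs0
        have h1 := aux_const (hcc c) hT hs hst x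
        have hcont : ContinuousOn (fun τ => L x (Tc c φ τ x) 0 + c) (Icc s t) :=
          (hcc c).comp_continuousOn (f := fun τ => (x, Tc c φ τ x, (0 : Fin n → ℝ)))
            (continuousOn_const.prodMk
              ((huc.mono (Icc_subset_Icc hs ht)).prodMk continuousOn_const))
        have h3 : ∫ τ in s..t, (L x (Tc c φ τ x) 0 + c) ≤ ∫ τ in s..t, lam * M := by
          refine intervalIntegral.integral_mono_on hst
            (hcont.intervalIntegrable_of_Icc hst) (by simp) (fun τ hτ => ?_)
          obtain ⟨g1, g2⟩ := hM τ hτ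
          have g3 := le_of_abs_le (hA x)
          have g4 := le_of_abs_le (hLip x 0 (Tc c φ τ x) (φ x))
          rw [abs_of_nonneg g1] at g4
          have g6 : lam * (Tc c φ τ x - φ x) ≤ lam * M := by gcongr
          linarith
        rw [intervalIntegral.integral_const, smul_eq_mul] at h3
        linarith)
    linarith
end
end

section
/- Finiteness thresholds (Lemma 5.2): Under the stated assumptions, for each ℤⁿ-periodic φ ∈ C(ℝⁿ,ℝ): (i) there exists c' ∈ ℝ such that for every c ≤ c', sup_{(x,t) ∈ ℝⁿ × [0,+∞)} T^c_tφ(x) < +∞; (ii) there exists c'' ∈ ℝ such that for every c ≥ c'', inf_{(x,t) ∈ ℝⁿ × [0,+∞)} T^c_tφ(x) > −∞. Consequently, c₁ := inf{ c : sup_{(x,t)} T^c_tφ(x) = +∞ } satisfies −∞ < c₁ ≤ +∞, and c₂ := sup{ c : inf_{(x,t)} T^c_tφ(x) = −∞ } satisfies −∞ ≤ c₂ < +∞. -/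
open Set Filter

noncomputable section

/-- **Finiteness thresholds (Lemma 5.2).**
Under the stated assumptions on the semigroups `Tc c` for `L + c`
(semigroup property, monotonicity in the initial datum and in `c`, and the
conclusion of Lemma 5.1), for each `ℤⁿ`-periodic continuous `φ`:
(i) for all sufficiently negative `c`, `T^c_t φ` is bounded above uniformly in
`(x,t) ∈ ℝⁿ × [0,∞)`; (ii) for all sufficiently positive `c`, it is bounded
below uniformly.  Consequently the set of `c` with unbounded-above orbit is
bounded below (`c₁ > -∞`) and the set of `c` with unbounded-below orbit is
bounded above (`c₂ < +∞`). -/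
theorem finiteness_thresholds
    (n : ℕ) (hn : 1 ≤ n) (lam : ℝ)
    (L : (Fin n → ℝ) → ℝ → (Fin n → ℝ) → ℝ)
    (hL : IsContactLagrangian n lam L)
    (Tc : ℝ → ((Fin n → ℝ) → ℝ) → ℝ → (Fin n → ℝ) → ℝ)
    (hTc : ∀ (c : ℝ) (ψ : (Fin n → ℝ) → ℝ), PerCont n ψ →
      BackwardSemigroup n (fun x u v => L x u v + c) ψ (Tc c ψ))
    (hsg : ∀ (c : ℝ) (ψ : (Fin n → ℝ) → ℝ), PerCont n ψ →
      ∀ s t : ℝ, 0 ≤ s → 0 ≤ t → ∀ x : Fin n → ℝ,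
        Tc c ψ (t + s) x = Tc c (fun y => Tc c ψ s y) t x)
    (hmonoφ : ∀ (c : ℝ) (ψ₁ ψ₂ : (Fin n → ℝ) → ℝ), PerCont n ψ₁ → PerCont n ψ₂ →
      (∀ x, ψ₁ x ≤ ψ₂ x) → ∀ t : ℝ, 0 ≤ t → ∀ x : Fin n → ℝ,
        Tc c ψ₁ t x ≤ Tc c ψ₂ t x)
    (hmonoc : ∀ c c' : ℝ, c ≤ c' → ∀ ψ : (Fin n → ℝ) → ℝ, PerCont n ψ →
      ∀ t : ℝ, 0 ≤ t → ∀ x : Fin n → ℝ, Tc c ψ t x ≤ Tc c' ψ t x)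
    (φ : (Fin n → ℝ) → ℝ) (hφ : PerCont n φ)
    (hcomp : ∃ ct : ℝ, 0 < ct ∧
      (∀ c : ℝ, ct ≤ c → ∀ x : Fin n → ℝ, φ x ≤ Tc c φ 1 x) ∧
      (∀ c : ℝ, c ≤ -ct → ∀ x : Fin n → ℝ, Tc c φ 1 x ≤ φ x)) :
    (∃ c' : ℝ, ∀ c : ℝ, c ≤ c' →
      ∃ M : ℝ, ∀ (x : Fin n → ℝ) (t : ℝ), 0 ≤ t → Tc c φ t x ≤ M) ∧
    (∃ c'' : ℝ, ∀ c : ℝ, c'' ≤ c →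
      ∃ m : ℝ, ∀ (x : Fin n → ℝ) (t : ℝ), 0 ≤ t → m ≤ Tc c φ t x) ∧
    BddBelow {c : ℝ | ¬ ∃ M : ℝ, ∀ (x : Fin n → ℝ) (t : ℝ), 0 ≤ t → Tc c φ t x ≤ M} ∧
    BddAbove {c : ℝ | ¬ ∃ m : ℝ, ∀ (x : Fin n → ℝ) (t : ℝ), 0 ≤ t → m ≤ Tc c φ t x} := by
  have key : ∀ c : ℝ, ∃ m M : ℝ, ∀ (x : Fin n → ℝ) (t : ℝ), 0 ≤ t → t ≤ 1 →
      m ≤ Tc c φ t x ∧ Tc c φ t x ≤ M := by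
    intro c
    obtain ⟨hc, hper, -, -⟩ := hTc c φ hφ
    have hK : IsCompact ((Set.Icc (0 : Fin n → ℝ) 1) ×ˢ (Set.Icc (0:ℝ) 1)) :=
      isCompact_Icc.prod isCompact_Icc
    have hc' : ContinuousOn (fun q : (Fin n → ℝ) × ℝ => Tc c φ q.2 q.1)
        ((Set.Icc (0 : Fin n → ℝ) 1) ×ˢ (Set.Icc (0:ℝ) 1)) :=
      hc.mono (fun q hq => ⟨trivial, hq.2.1⟩)
    obtain ⟨m, hm⟩ := hK.bddBelow_image hc'
    obtain ⟨M, hM⟩ := hK.bddAbove_image hc'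
    refine ⟨m, M, fun x t h0 h1 => ?_⟩
    have e : Tc c φ t x = Tc c φ t (fun i => Int.fract (x i)) := by
      rw [← hper t h0 (fun i => Int.fract (x i)) (fun i => ⌊x i⌋)]
      congr 1
      funext i
      exact (Int.fract_add_floor (x i)).symm
    have hmem : ((fun i => Int.fract (x i) : Fin n → ℝ), t) ∈
        (Set.Icc (0 : Fin n → ℝ) 1) ×ˢ (Set.Icc (0:ℝ) 1) :=
      ⟨⟨fun i => Int.fract_nonneg _, fun i => (Int.fract_lt_one _).le⟩, h0, h1⟩
    rw [e]
    exact ⟨hm ⟨_, hmem, rfl⟩, hM ⟨_, hmem, rfl⟩⟩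
  have pc : ∀ c : ℝ, PerCont n (fun y => Tc c φ 1 y) := by
    intro c
    obtain ⟨hc, hper, -, -⟩ := hTc c φ hφ
    refine ⟨?_, hper 1 zero_le_one⟩
    exact hc.comp_continuous (f := fun y : Fin n → ℝ => (y, (1:ℝ))) (by fun_prop)
      (fun y => ⟨trivial, zero_le_one (α := ℝ)⟩)
  obtain ⟨ct, -, hup, hdn⟩ := hcomp
  have A : ∀ c : ℝ, c ≤ -ct →
      ∃ M : ℝ, ∀ (x : Fin n → ℝ) (t : ℝ), 0 ≤ t → Tc c φ t x ≤ M := by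
    intro c hc
    obtain ⟨m, M, h⟩ := key c
    refine ⟨M, fun x t ht => ?_⟩
    have ind : ∀ k : ℕ, ∀ s : ℝ, 0 ≤ s → s ≤ 1 → Tc c φ (s + k) x ≤ M := by
      intro k
      induction k with
      | zero => intro s h0 h1; simpa using (h x s h0 h1).2
      | succ k ih =>
        intro s h0 h1
        refine le_trans ?_ (ih s h0 h1)
        have hk : 0 ≤ s + (k:ℝ) := by positivity
        rw [Nat.cast_succ, ← add_assoc, hsg c φ hφ 1 (s + k) zero_le_one hk]
        exact hmonoφ c _ _ (pc c) hφ (hdn c hc) _ hk x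
    have := ind ⌊t⌋₊ (t - ⌊t⌋₊) (sub_nonneg.2 (Nat.floor_le ht))
      (by linarith [Nat.lt_floor_add_one t])
    simpa using this
  have B : ∀ c : ℝ, ct ≤ c →
      ∃ m : ℝ, ∀ (x : Fin n → ℝ) (t : ℝ), 0 ≤ t → m ≤ Tc c φ t x := by
    intro c hc
    obtain ⟨m, M, h⟩ := key c
    refine ⟨m, fun x t ht => ?_⟩
    have ind : ∀ k : ℕ, ∀ s : ℝ, 0 ≤ s → s ≤ 1 → m ≤ Tc c φ (s + k) x := by
      intro k
      induction k with
      | zero => intro s h0 h1; simpa using (h x s h0 h1).1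
      | succ k ih =>
        intro s h0 h1
        refine le_trans (ih s h0 h1) ?_
        have hk : 0 ≤ s + (k:ℝ) := by positivity
        rw [Nat.cast_succ, ← add_assoc, hsg c φ hφ 1 (s + k) zero_le_one hk]
        exact hmonoφ c _ _ hφ (pc c) (hup c hc) _ hk x
    have := ind ⌊t⌋₊ (t - ⌊t⌋₊) (sub_nonneg.2 (Nat.floor_le ht))
      (by linarith [Nat.lt_floor_add_one t])
    simpa using this
  refine ⟨⟨-ct, A⟩, ⟨ct, B⟩, ⟨-ct, fun c hc => ?_⟩, ⟨ct, fun c hc => ?_⟩⟩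
  · by_contra hlt
    exact hc (A c (not_le.1 hlt).le)
  · by_contra hlt
    exact hc (B c (not_le.1 hlt).le)
end
end
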